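/- arXiv:2006.13356 — 6 statements merged into one kernel-verified Lean document; each statement's English description precedes it below -/
import Mathlib

section
/- Let A and B be sets of natural numbers. If the natural density of A is 1 and the natural density of B is 1, then the product set A·B = {a·b : a ∈ A, b ∈ B} has natural density 1. -/
open Filter Topology Pointwise
open scoped Classical

/-- The natural density of a set `A` of positive integers is `d` if
`#(A ∩ [1,N]) / N → d` as `N → ∞`. -/
noncomputable def HasDensity (A : Set ℕ) (d : ℝ) : Prop :=
  Filter.Tendsto
    (fun N : ℕ => (((Finset.Icc 1 N).filter (fun n => n ∈ A)).card : ℝ) / N)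
    Filter.atTop (nhds d)

open ArithmeticFunction ArithmeticFunction.zeta ArithmeticFunction.Moebius

/-- The completely multiplicative arithmetic function `n ↦ n ^ (-t)`. -/
noncomputable def negPow (t : ℝ) : ArithmeticFunction ℝ :=
  ⟨fun n => if n = 0 then 0 else (n : ℝ) ^ (-t), by simp⟩

/-- The arithmetic function `n ↦ ∑ d ∣ n, μ d * d ^ (-t)`, which is the Dirichlet quotient of
`1` by `n ↦ n ^ (-t)`. -/
noncomputable def zetaQuot (t : ℝ) : ArithmeticFunction ℝ :=
  pmul (μ : ArithmeticFunction ℝ) (negPow t) * (ζ : ArithmeticFunction ℝ)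

theorem negPow_apply {t : ℝ} {n : ℕ} (hn : n ≠ 0) : negPow t n = (n : ℝ) ^ (-t) := by
  simp [negPow, hn]

theorem negPow_nonneg (t : ℝ) (n : ℕ) : 0 ≤ negPow t n := by
  rcases eq_or_ne n 0 with rfl | hn
  · simp
  · rw [negPow_apply hn]; positivity

theorem negPow_le_one {t : ℝ} (ht : 0 ≤ t) (n : ℕ) : negPow t n ≤ 1 := by
  rcases eq_or_ne n 0 with rfl | hn
  · simp
  · rw [negPow_apply hn]
    exact Real.rpow_le_one_of_one_le_of_nonpos (by exact_mod_cast Nat.one_le_iff_ne_zero.2 hn)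
      (by linarith)

theorem negPow_one (t : ℝ) : negPow t 1 = 1 := by simp [negPow]

theorem negPow_mul (t : ℝ) (m n : ℕ) : negPow t (m * n) = negPow t m * negPow t n := by
  rcases eq_or_ne m 0 with rfl | hm
  · simp
  rcases eq_or_ne n 0 with rfl | hn
  · simp
  rw [negPow_apply hm, negPow_apply hn, negPow_apply (mul_ne_zero hm hn), Nat.cast_mul,
    Real.mul_rpow (by positivity) (by positivity)]

theorem isMultiplicative_negPow (t : ℝ) : (negPow t).IsMultiplicative :=
  ⟨negPow_one t, fun _ => negPow_mul t _ _⟩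

theorem negPow_mul_zetaQuot (t : ℝ) : negPow t * zetaQuot t = (ζ : ArithmeticFunction ℝ) := by
  have h : negPow t * pmul (μ : ArithmeticFunction ℝ) (negPow t) = 1 := by
    ext n
    have h1 : ((ζ : ArithmeticFunction ℝ) * (μ : ArithmeticFunction ℝ)) n
        = (1 : ArithmeticFunction ℝ) n := by rw [coe_zeta_mul_coe_moebius]
    have h2 : (negPow t * pmul (μ : ArithmeticFunction ℝ) (negPow t)) n
        = negPow t n * ((ζ : ArithmeticFunction ℝ) * (μ : ArithmeticFunction ℝ)) n := by
      rw [mul_apply, mul_apply, Finset.mul_sum]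
      refine Finset.sum_congr rfl fun x hx => ?_
      obtain ⟨hx1, hx2⟩ := Nat.mem_divisorsAntidiagonal.1 hx
      have hx0 : x.1 ≠ 0 := by rintro h; simp [h] at hx1; exact hx2 hx1.symm
      rw [← hx1, negPow_mul, pmul_apply, natCoe_apply, zeta_apply_ne hx0]
      push_cast
      ring
    rw [h2, h1]
    by_cases hn : n = 1
    · simp [hn, negPow_one]
    · simp [one_apply_ne hn]
  rw [zetaQuot, ← mul_assoc, h, one_mul]

theorem isMultiplicative_zetaQuot (t : ℝ) : (zetaQuot t).IsMultiplicative :=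
  (isMultiplicative_moebius.intCast.pmul (isMultiplicative_negPow t)).mul
    isMultiplicative_zeta.natCast

theorem zetaQuot_prime_pow (t : ℝ) {p k : ℕ} (hp : p.Prime) (hk : k ≠ 0) :
    zetaQuot t (p ^ k) = 1 - negPow t p := by
  obtain ⟨k, rfl⟩ := Nat.exists_eq_succ_of_ne_zero hk
  rw [zetaQuot, coe_mul_zeta_apply, Nat.sum_divisors_prime_pow hp, Finset.sum_range_succ',
    Finset.sum_range_succ', Finset.sum_eq_zero]
  · simp [moebius_apply_prime hp, negPow_one]
    ring
  · intro i _
    simp [moebius_apply_prime_pow hp]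

theorem zetaQuot_mem_Icc {t : ℝ} (ht : 0 ≤ t) (n : ℕ) : zetaQuot t n ∈ Set.Icc (0 : ℝ) 1 := by
  rcases eq_or_ne n 0 with rfl | hn
  · simp
  rw [(isMultiplicative_zetaQuot t).multiplicative_factorization _ hn]
  have h : ∀ p ∈ n.factorization.support,
      zetaQuot t (p ^ n.factorization p) = 1 - negPow t p := fun p hp =>
    zetaQuot_prime_pow t (Nat.prime_of_mem_primeFactors hp) (Finsupp.mem_support_iff.1 hp)
  rw [Finsupp.prod, Finset.prod_congr rfl h]
  exact ⟨Finset.prod_nonneg fun p _ => by linarith [negPow_le_one ht p],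
    Finset.prod_le_one (fun p _ => by linarith [negPow_le_one ht p])
      fun p _ => by linarith [negPow_nonneg t p]⟩

theorem tendsto_natDiv_div (m : ℕ) :
    Tendsto (fun N : ℕ => ((N / m : ℕ) : ℝ) / N) atTop (𝓝 (m : ℝ)⁻¹) := by
  refine ((tendsto_nat_floor_mul_div_atTop (R := ℝ) (a := (m : ℝ)⁻¹) (by positivity)).comp
    tendsto_natCast_atTop_atTop).congr fun N => ?_
  simp only [Function.comp_apply]
  rw [← Nat.floor_div_eq_div (K := ℝ), inv_mul_eq_div]

theorem summable_negPow_mul_inv {t : ℝ} (ht : 0 < t) :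
    Summable fun m : ℕ => negPow t m * (m : ℝ)⁻¹ := by
  refine (Real.summable_nat_rpow_inv.2 (by linarith : 1 < 1 + t)).congr_atTop ?_
  filter_upwards [eventually_gt_atTop 0] with n hn
  rw [negPow_apply hn.ne', Real.rpow_add (by positivity), Real.rpow_neg (by positivity),
    Real.rpow_one]
  field_simp

theorem tendsto_sum_zetaQuot_div {t : ℝ} (ht : 0 < t) :
    Tendsto (fun N : ℕ => (∑ k ∈ Finset.Ioc 0 N, zetaQuot t k) / N) atTop
      (𝓝 (∑' m : ℕ, (μ m : ℝ) * (negPow t m * (m : ℝ)⁻¹))) := by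
  have key : Tendsto (fun N : ℕ => ∑' m : ℕ, (μ m : ℝ) * (negPow t m * (((N / m : ℕ) : ℝ) / N)))
      atTop (𝓝 (∑' m : ℕ, (μ m : ℝ) * (negPow t m * (m : ℝ)⁻¹))) := by
    refine tendsto_tsum_of_dominated_convergence (summable_negPow_mul_inv ht) (fun m => ?_) ?_
    · exact ((tendsto_natDiv_div m).const_mul _).const_mul _
    · refine Eventually.of_forall fun N m => ?_
      have h1 : |(μ m : ℝ)| ≤ 1 := by exact_mod_cast abs_moebius_le_one
      have h2 : ((N / m : ℕ) : ℝ) / N ≤ (m : ℝ)⁻¹ := by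
        rcases eq_or_ne N 0 with rfl | hN
        · simp
        · rw [div_le_iff₀ (by positivity), ← div_eq_inv_mul]
          exact Nat.cast_div_le
      have h3 := negPow_nonneg t m
      rw [Real.norm_eq_abs, abs_mul, abs_of_nonneg (a := negPow t m * _) (by positivity)]
      calc |(μ m : ℝ)| * (negPow t m * (((N / m : ℕ) : ℝ) / N))
          ≤ 1 * (negPow t m * (((N / m : ℕ) : ℝ) / N)) := by gcongr
        _ ≤ negPow t m * (m : ℝ)⁻¹ := by rw [one_mul]; gcongr
  refine key.congr fun N => ?_
  rw [zetaQuot, sum_Ioc_mul_zeta_eq_sum, Finset.sum_div, tsum_eq_sum (s := Finset.Ioc 0 N)]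
  · refine Finset.sum_congr rfl fun m _ => ?_
    simp only [pmul_apply, intCoe_apply]
    ring
  · intro m hm
    rcases eq_or_ne m 0 with rfl | hm0
    · simp
    · have : N / m = 0 := Nat.div_eq_of_lt (by simp at hm; omega)
      simp [this]

/-- The Dirichlet series `∑ n ∈ A, n ^ (-(1 + t))`. -/
noncomputable def setZeta (A : Set ℕ) (t : ℝ) : ℝ :=
  ∑' n : ℕ, A.indicator 1 n * (negPow t n * (n : ℝ)⁻¹)

theorem term_ofReal_eq (f : ℕ → ℝ) {s : ℝ} (n : ℕ) :
    LSeries.term (fun n => (f n : ℂ)) s n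
      = ((f n * (negPow (s - 1) n * (n : ℝ)⁻¹) : ℝ) : ℂ) := by
  rcases eq_or_ne n 0 with rfl | hn
  · simp
  have hn' : (0 : ℝ) < n := by positivity
  have h : negPow (s - 1) n * (n : ℝ)⁻¹ = ((n : ℝ) ^ s)⁻¹ := by
    rw [negPow_apply hn, ← Real.rpow_neg_one, ← Real.rpow_add hn', ← Real.rpow_neg hn'.le]
    ring_nf
  rw [LSeries.term_of_ne_zero hn, h]
  push_cast [Complex.ofReal_cpow hn'.le]
  rw [div_eq_mul_inv]

theorem LSeries_ofReal_eq (f : ℕ → ℝ) (s : ℝ) :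
    LSeries (fun n => (f n : ℂ)) s
      = ((∑' n : ℕ, f n * (negPow (s - 1) n * (n : ℝ)⁻¹) : ℝ) : ℂ) := by
  rw [LSeries, Complex.ofReal_tsum]
  exact tsum_congr (term_ofReal_eq f)

theorem tsum_moebius_mul_setZeta_univ {t : ℝ} (ht : 0 < t) :
    (∑' m : ℕ, (μ m : ℝ) * (negPow t m * (m : ℝ)⁻¹)) * setZeta Set.univ t = 1 := by
  have h := LSeries_zeta_mul_Lseries_moebius (s := ((1 + t : ℝ) : ℂ))
    (by rw [Complex.ofReal_re]; linarith)
  have h1 : LSeries (fun n => ((ζ n : ℕ) : ℂ)) ((1 + t : ℝ) : ℂ) = (setZeta Set.univ t : ℂ) := by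
    rw [setZeta, ← add_sub_cancel_left 1 t, ← LSeries_ofReal_eq, add_sub_cancel_left]
    refine LSeries_congr (fun {n} hn => ?_) _
    simp [hn]
  have h2 := LSeries_ofReal_eq (fun n => (μ n : ℝ)) (1 + t)
  simp only [Complex.ofReal_intCast, add_sub_cancel_left] at h2
  rw [h1, h2] at h
  rw [mul_comm]
  exact_mod_cast h

theorem HasDensity.tendsto_mul_setZeta {A : Set ℕ} {l : ℝ} (hA : HasDensity A l) :
    Tendsto (fun s : ℝ => (s - 1) * setZeta A (s - 1)) (𝓝[>] 1) (𝓝 l) := by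
  have h := LSeries_tendsto_sub_mul_nhds_one_of_tendsto_sum_div
    (f := fun n => ((A.indicator 1 n : ℝ) : ℂ)) (l := l) ?_ ?_
  · rw [← tendsto_ofReal_iff]
    refine h.congr fun s => ?_
    rw [LSeries_ofReal_eq, setZeta]
    push_cast
    rfl
  · refine ((Complex.continuous_ofReal.tendsto l).comp (hA : Tendsto _ _ _)).congr fun N => ?_
    simp [Set.indicator_apply, apply_ite ((↑) : ℝ → ℂ)]
  · intro s hs
    refine LSeriesSummable_of_bounded_of_one_lt_real (m := 1) (fun n _ => ?_) hs
    by_cases h : n ∈ A <;> simp [h]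

theorem hasDensity_univ : HasDensity Set.univ 1 := by
  unfold HasDensity
  refine tendsto_const_nhds.congr' ?_
  filter_upwards [eventually_gt_atTop 0] with N hN
  simp [hN.ne']

/-- Weighting `n = d * k` by `d ^ (-t) * zetaQuot t k` gives a lower bound for the number of
elements of a product set. -/
theorem sum_negPow_mul_sum_zetaQuot_le_card {t : ℝ} (ht : 0 ≤ t) (A B : Set ℕ) (K N : ℕ) :
    ∑ d ∈ (Finset.Icc 1 K).filter (· ∈ A),
        negPow t d * ∑ k ∈ (Finset.Ioc 0 (N / d)).filter (· ∈ B), zetaQuot t k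
      ≤ (((Finset.Icc 1 N).filter (· ∈ A * B)).card : ℝ) := by
  simp_rw [Finset.mul_sum]
  rw [Finset.sum_sigma', ← Finset.sum_fiberwise_of_maps_to
    (t := (Finset.Icc 1 N).filter (· ∈ A * B)) (g := fun x => x.1 * x.2)]
  · rw [Finset.card_eq_sum_ones, Nat.cast_sum]
    refine Finset.sum_le_sum fun n hn => ?_
    have hn0 : n ≠ 0 := by
      have := (Finset.mem_Icc.1 (Finset.mem_filter.1 hn).1).1
      omega
    have h1 : (negPow t * zetaQuot t) n = 1 := by
      rw [negPow_mul_zetaQuot, natCoe_apply, zeta_apply_ne hn0, Nat.cast_one]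
    rw [Nat.cast_one, ← h1, mul_apply]
    refine (Finset.sum_map _ (Equiv.sigmaEquivProd ℕ ℕ).toEmbedding
      (fun x => negPow t x.1 * zetaQuot t x.2)).ge.trans ?_
    refine Finset.sum_le_sum_of_subset_of_nonneg ?_ fun x _ _ =>
      mul_nonneg (negPow_nonneg t _) (zetaQuot_mem_Icc ht _).1
    intro x hx
    obtain ⟨y, hy, rfl⟩ := Finset.mem_map.1 hx
    exact Nat.mem_divisorsAntidiagonal.2 ⟨(Finset.mem_filter.1 hy).2, hn0⟩
  · rintro ⟨d, k⟩ hx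
    simp only [Finset.mem_sigma, Finset.mem_filter, Finset.mem_Icc, Finset.mem_Ioc] at hx ⊢
    obtain ⟨⟨⟨hd, -⟩, hdA⟩, ⟨hk, hkN⟩, hkB⟩ := hx
    refine ⟨⟨Nat.mul_pos hd hk, ?_⟩, Set.mul_mem_mul hdA hkB⟩
    rw [mul_comm]
    exact (Nat.le_div_iff_mul_le hd).1 hkN

theorem HasDensity.tendsto_sum_zetaQuot_div {t : ℝ} (ht : 0 < t) {B : Set ℕ}
    (hB : HasDensity B 1) :
    Tendsto (fun N : ℕ => (∑ k ∈ (Finset.Ioc 0 N).filter (· ∈ B), zetaQuot t k) / N) atTop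
      (𝓝 (∑' m : ℕ, (μ m : ℝ) * (negPow t m * (m : ℝ)⁻¹))) := by
  have hcompl : Tendsto _ _ _ := Tendsto.sub hasDensity_univ hB
  have hlow := (_root_.tendsto_sum_zetaQuot_div ht).sub hcompl
  rw [sub_self, sub_zero] at hlow
  refine tendsto_of_tendsto_of_tendsto_of_le_of_le hlow (_root_.tendsto_sum_zetaQuot_div ht)
    (fun N => ?_) fun N => ?_
  · simp only
    rw [← sub_div, ← sub_div]
    gcongr
    have hsplit := Finset.sum_filter_add_sum_filter_not (Finset.Ioc 0 N) (· ∈ B)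
      (fun k => zetaQuot t k)
    have hcard := Finset.card_filter_add_card_filter_not (s := Finset.Icc 1 N) (· ∈ B)
    have hle : ∑ k ∈ (Finset.Ioc 0 N).filter (· ∉ B), zetaQuot t k
        ≤ (((Finset.Icc 1 N).filter (· ∉ B)).card : ℝ) := by
      rw [Finset.card_eq_sum_ones, Nat.cast_sum]
      exact Finset.sum_le_sum fun k _ => by simpa using (zetaQuot_mem_Icc ht.le k).2
    have hcard' : (((Finset.Icc 1 N).filter (· ∈ B)).card : ℝ)
        + (((Finset.Icc 1 N).filter (· ∉ B)).card : ℝ)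
        = ((Finset.Icc 1 N).card : ℝ) := by exact_mod_cast hcard
    simp only [Set.mem_univ, Finset.filter_true]
    linarith
  · simp only
    gcongr
    · exact fun k _ _ => (zetaQuot_mem_Icc ht.le k).1
    · exact Finset.filter_subset _ _

theorem eventually_lt_card_mul_div {t : ℝ} (ht : 0 < t) {A B : Set ℕ} (hB : HasDensity B 1)
    {a : ℝ}
    (ha : a < (∑' m : ℕ, (μ m : ℝ) * (negPow t m * (m : ℝ)⁻¹)) * setZeta A t) :
    ∀ᶠ N : ℕ in atTop, a < (((Finset.Icc 1 N).filter (· ∈ A * B)).card : ℝ) / N := by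
  set c := ∑' m : ℕ, (μ m : ℝ) * (negPow t m * (m : ℝ)⁻¹) with hc
  have hsum : Summable fun n : ℕ => A.indicator 1 n * (negPow t n * (n : ℝ)⁻¹) := by
    refine (summable_negPow_mul_inv ht).of_nonneg_of_le (fun n => ?_) fun n => ?_ <;>
    have := negPow_nonneg t n <;>
    by_cases h : n ∈ A <;> simp [h] <;> positivity
  have hK := (hsum.hasSum.tendsto_sum_nat.comp (tendsto_add_atTop_nat 1)).const_mul c
  obtain ⟨K, hK⟩ := (hK.eventually (lt_mem_nhds ha)).exists
  have hfin : ∑ n ∈ Finset.range (K + 1), A.indicator 1 n * (negPow t n * (n : ℝ)⁻¹)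
      = ∑ d ∈ (Finset.Icc 1 K).filter (· ∈ A), negPow t d * (d : ℝ)⁻¹ := by
    rw [Finset.sum_filter, Finset.range_eq_Ico, Finset.sum_eq_sum_Ico_succ_bot (by omega)]
    rw [ArithmeticFunction.map_zero, zero_mul, mul_zero, zero_add]
    exact Finset.sum_congr (by ext; simp) fun n _ => by simp [Set.indicator_apply]
  simp only [Function.comp_apply] at hK
  rw [hfin, Finset.mul_sum] at hK
  have hlim : Tendsto (fun N : ℕ => ∑ d ∈ (Finset.Icc 1 K).filter (· ∈ A),
      negPow t d * ((∑ k ∈ (Finset.Ioc 0 (N / d)).filter (· ∈ B), zetaQuot t k)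
        / ((N / d : ℕ) : ℝ) * (((N / d : ℕ) : ℝ) / N))) atTop
      (𝓝 (∑ d ∈ (Finset.Icc 1 K).filter (· ∈ A), c * (negPow t d * (d : ℝ)⁻¹))) := by
    refine tendsto_finsetSum _ fun d hd => ?_
    have hd0 : d ≠ 0 := by
      have := (Finset.mem_Icc.1 (Finset.mem_filter.1 hd).1).1
      omega
    rw [mul_left_comm]
    exact (((hB.tendsto_sum_zetaQuot_div ht).comp (Nat.tendsto_div_const_atTop hd0)).mul
      (tendsto_natDiv_div d)).const_mul _
  filter_upwards [hlim.eventually (lt_mem_nhds hK)] with N hN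
  refine hN.trans_le (le_trans (le_of_eq ?_)
    (div_le_div_of_nonneg_right (sum_negPow_mul_sum_zetaQuot_le_card ht.le A B K N) N.cast_nonneg))
  rw [Finset.sum_div]
  refine Finset.sum_congr rfl fun d _ => ?_
  rw [mul_div_assoc]
  rcases eq_or_ne (N / d) 0 with h | h
  · simp [h]
  · rw [div_mul_div_cancel₀ (by exact_mod_cast h)]

theorem product_of_density_one_sets_has_density_one
    (A B : Set ℕ) (hA : HasDensity A 1) (hB : HasDensity B 1) :
    HasDensity (A * B) 1 := by
  unfold HasDensity
  refine tendsto_order.2 ⟨fun a ha => ?_, fun a ha => Eventually.of_forall fun N => ?_⟩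
  · have hlim := hA.tendsto_mul_setZeta.div hasDensity_univ.tendsto_mul_setZeta one_ne_zero
    rw [div_one] at hlim
    obtain ⟨s, hs, hs1⟩ := ((hlim.eventually (lt_mem_nhds ha)).and self_mem_nhdsWithin).exists
    have ht : 0 < s - 1 := sub_pos.2 hs1
    refine eventually_lt_card_mul_div ht hB ?_
    have hc := tsum_moebius_mul_setZeta_univ ht
    rw [eq_div_of_mul_eq (right_ne_zero_of_mul_eq_one hc) hc, one_div_mul_eq_div]
    simpa [mul_div_mul_left _ _ ht.ne'] using hs
  · refine lt_of_le_of_lt (div_le_one_of_le₀ ?_ N.cast_nonneg) ha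
    have := Finset.card_filter_le (Finset.Icc 1 N) (· ∈ A * B)
    rw [Nat.card_Icc, Nat.add_sub_cancel] at this
    exact_mod_cast this
end

section
/- There exists an absolute constant C > 0 such that for all real numbers x ≥ y > 1, the number Φ(x,y) of positive integers n ≤ x all of whose prime factors exceed y satisfies Φ(x,y) ≤ C·x/log y. -/
open scoped Classical

/-- `Phi x y` counts positive integers `n ≤ x` all of whose prime factors exceed `y`
(in particular `n = 1` is counted). -/
noncomputable def Phi (x y : ℝ) : ℕ :=
  ((Finset.Icc 1 ⌊x⌋₊).filter
    (fun n => ∀ p : ℕ, p.Prime → p ∣ n → y < (p : ℝ))).card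

/-- The set of positive integers `n ≤ x` all of whose prime factors exceed `y`. -/
noncomputable def roughFinset (x y : ℝ) : Finset ℕ :=
  (Finset.Icc 1 ⌊x⌋₊).filter (fun n => ∀ p : ℕ, p.Prime → p ∣ n → y < (p : ℝ))

theorem mem_roughFinset {x y : ℝ} {n : ℕ} :
    n ∈ roughFinset x y ↔
      (1 ≤ n ∧ n ≤ ⌊x⌋₊) ∧ ∀ p : ℕ, p.Prime → p ∣ n → y < (p : ℝ) := by
  simp only [roughFinset, Finset.mem_filter, Finset.mem_Icc]

theorem mem_roughFinset_of_dvd {x y : ℝ} {m n : ℕ} (h : n ∈ roughFinset x y) (hmn : m ∣ n) :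
    m ∈ roughFinset x y := by
  obtain ⟨⟨h1, h2⟩, h3⟩ := mem_roughFinset.1 h
  exact mem_roughFinset.2 ⟨⟨Nat.pos_of_dvd_of_pos hmn h1, (Nat.le_of_dvd h1 hmn).trans h2⟩,
    fun p hp hpm => h3 p hp (hpm.trans hmn)⟩

theorem coprime_of_mem_roughFinset {x y : ℝ} {m k : ℕ} (h : m ∈ roughFinset x y)
    (hk : 1 ≤ k) (hky : (k : ℝ) ≤ y) : Nat.Coprime m k := by
  refine Nat.coprime_of_dvd fun p hp hpm hpk => ?_
  have h1 := (mem_roughFinset.1 h).2 p hp hpm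
  have h2 : (p : ℝ) ≤ k := by exact_mod_cast Nat.le_of_dvd hk hpk
  linarith

/-- Products of a rough number with an integer `k ≤ y` are pairwise distinct, which bounds the
reciprocal sum of rough numbers by a quotient of harmonic sums. -/
theorem sum_inv_roughFinset_mul_log_le {x y : ℝ} (hy : 1 ≤ y) (hyx : y ≤ x) :
    (∑ m ∈ roughFinset x y, (m : ℝ)⁻¹) * Real.log y ≤ 1 + 2 * Real.log x := by
  set R := roughFinset x y
  set K := Finset.Icc 1 ⌊y⌋₊
  have hK : ∀ k ∈ K, 1 ≤ k ∧ (k : ℝ) ≤ y := by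
    intro k hk
    obtain ⟨h1, h2⟩ := Finset.mem_Icc.1 hk
    exact ⟨h1, (Nat.le_floor_iff' (by lia)).1 h2⟩
  have hharm : ∀ n : ℕ, ((harmonic n : ℚ) : ℝ) = ∑ k ∈ Finset.Icc 1 n, (k : ℝ)⁻¹ := by
    intro n
    rw [harmonic_eq_sum_Icc]
    push_cast
    rfl
  have hlog : Real.log y ≤ ∑ k ∈ K, (k : ℝ)⁻¹ := by
    rw [← hharm]
    refine le_trans (Real.log_le_log (by linarith) ?_) (log_add_one_le_harmonic _)
    push_cast
    exact (Nat.lt_floor_add_one y).le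
  have hinj : Set.InjOn (fun q : ℕ × ℕ => q.1 * q.2) (R ×ˢ K : Finset (ℕ × ℕ)) := by
    rintro ⟨m, k⟩ h ⟨m', k'⟩ h' heq
    simp only [Finset.coe_product, Set.mem_prod, Finset.mem_coe] at h h'
    dsimp only at heq
    have hm : m ∣ m' :=
      (coprime_of_mem_roughFinset h.1 (hK _ h'.2).1 (hK _ h'.2).2).dvd_of_dvd_mul_right
        (Dvd.intro _ heq)
    have hm' : m' ∣ m :=
      (coprime_of_mem_roughFinset h'.1 (hK _ h.2).1 (hK _ h.2).2).dvd_of_dvd_mul_right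
        (Dvd.intro _ heq.symm)
    obtain rfl := Nat.dvd_antisymm hm hm'
    have := Nat.eq_of_mul_eq_mul_left (mem_roughFinset.1 h.1).1.1 heq
    rw [this]
  have hsub : (R ×ˢ K).image (fun q : ℕ × ℕ => q.1 * q.2) ⊆ Finset.Icc 1 (⌊x⌋₊ * ⌊y⌋₊) := by
    intro n hn
    obtain ⟨⟨m, k⟩, h, rfl⟩ := Finset.mem_image.1 hn
    obtain ⟨h1, h2⟩ := Finset.mem_product.1 h
    have h3 := (mem_roughFinset.1 h1).1
    have h4 := Finset.mem_Icc.1 h2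
    exact Finset.mem_Icc.2 ⟨Nat.mul_pos h3.1 h4.1, Nat.mul_le_mul h3.2 h4.2⟩
  have hfx : 1 ≤ ⌊x⌋₊ := Nat.le_floor (by push_cast; linarith)
  have hfy : 1 ≤ ⌊y⌋₊ := Nat.le_floor (by push_cast; linarith)
  calc (∑ m ∈ R, (m : ℝ)⁻¹) * Real.log y
      ≤ (∑ m ∈ R, (m : ℝ)⁻¹) * ∑ k ∈ K, (k : ℝ)⁻¹ := by gcongr
    _ = ∑ q ∈ R ×ˢ K, ((q.1 * q.2 : ℕ) : ℝ)⁻¹ := by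
        rw [Finset.sum_mul_sum, Finset.sum_product]
        refine Finset.sum_congr rfl fun m _ => Finset.sum_congr rfl fun k _ => ?_
        push_cast
        rw [mul_inv]
    _ = ∑ n ∈ (R ×ˢ K).image (fun q : ℕ × ℕ => q.1 * q.2), (n : ℝ)⁻¹ :=
        (Finset.sum_image (f := fun n : ℕ => (n : ℝ)⁻¹) hinj).symm
    _ ≤ ∑ n ∈ Finset.Icc 1 (⌊x⌋₊ * ⌊y⌋₊), (n : ℝ)⁻¹ :=
        Finset.sum_le_sum_of_subset_of_nonneg hsub fun _ _ _ => by positivity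
    _ ≤ 1 + Real.log ((⌊x⌋₊ * ⌊y⌋₊ : ℕ) : ℝ) := by
        rw [← hharm]
        exact harmonic_le_one_add_log _
    _ ≤ 1 + Real.log (x * x) := by
        refine add_le_add_right (Real.log_le_log (by exact_mod_cast Nat.mul_pos hfx hfy) ?_) 1
        push_cast
        exact mul_le_mul (Nat.floor_le (by linarith))
          ((Nat.floor_le (by linarith)).trans hyx) (by positivity) (by linarith)
    _ = 1 + 2 * Real.log x := by
        rw [Real.log_mul (by linarith) (by linarith)]
        ring

/-- Writing `log = Λ * 1` and applying Chebyshev's bound to the sum over the quotients. -/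
theorem sum_log_roughFinset_le {x y : ℝ} (hx : 0 ≤ x) :
    ∑ n ∈ roughFinset x y, Real.log n ≤
      (Real.log 4 + 4) * x * ∑ m ∈ roughFinset x y, (m : ℝ)⁻¹ := by
  set R := roughFinset x y
  have hlog : ∀ n ∈ R, Real.log n =
      ∑ m ∈ R, if m ∣ n then ArithmeticFunction.vonMangoldt (n / m) else 0 := by
    intro n hn
    have hn0 : n ≠ 0 := Nat.one_le_iff_ne_zero.1 (mem_roughFinset.1 hn).1.1
    rw [← ArithmeticFunction.vonMangoldt_sum, ← Nat.sum_div_divisors, ← Finset.sum_filter]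
    refine Finset.sum_congr ?_ fun _ _ => rfl
    ext m
    simp only [Nat.mem_divisors, Finset.mem_filter]
    exact ⟨fun h => ⟨mem_roughFinset_of_dvd hn h.1, h.1⟩, fun h => ⟨h.2, hn0⟩⟩
  rw [Finset.sum_congr rfl hlog, Finset.sum_comm, Finset.mul_sum]
  refine Finset.sum_le_sum fun m hm => ?_
  have hm1 : 1 ≤ m := (mem_roughFinset.1 hm).1.1
  rw [← Finset.sum_filter]
  have hinj : Set.InjOn (fun n : ℕ => n / m) (R.filter (m ∣ ·)) := by
    intro a ha b hb hab
    exact (Nat.div_left_inj (Finset.mem_filter.1 ha).2 (Finset.mem_filter.1 hb).2).1 hab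
  have hsub : (R.filter (m ∣ ·)).image (fun n : ℕ => n / m) ⊆ Finset.Ioc 0 ⌊x / m⌋₊ := by
    intro d hd
    obtain ⟨n, hn, rfl⟩ := Finset.mem_image.1 hd
    obtain ⟨hnR, hmn⟩ := Finset.mem_filter.1 hn
    have hn' := (mem_roughFinset.1 hnR).1
    rw [Nat.floor_div_natCast]
    exact Finset.mem_Ioc.2 ⟨Nat.div_pos (Nat.le_of_dvd hn'.1 hmn) hm1,
      Nat.div_le_div_right hn'.2⟩
  calc ∑ n ∈ R.filter (m ∣ ·), ArithmeticFunction.vonMangoldt (n / m)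
      = ∑ d ∈ (R.filter (m ∣ ·)).image (fun n : ℕ => n / m),
          ArithmeticFunction.vonMangoldt d :=
        (Finset.sum_image (f := fun d => ArithmeticFunction.vonMangoldt d) hinj).symm
    _ ≤ Chebyshev.psi (x / m) :=
        Finset.sum_le_sum_of_subset_of_nonneg hsub
          fun _ _ _ => ArithmeticFunction.vonMangoldt_nonneg
    _ ≤ (Real.log 4 + 4) * (x / m) := Chebyshev.psi_le_const_mul_self (by positivity)
    _ = (Real.log 4 + 4) * x * (m : ℝ)⁻¹ := by ring

theorem card_roughFinset_mul_log_le {x y : ℝ} (hx : 0 < x) :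
    ((roughFinset x y).card : ℝ) * Real.log x ≤
      (Real.log 4 + 5) * x * ∑ m ∈ roughFinset x y, (m : ℝ)⁻¹ := by
  have h : ((roughFinset x y).card : ℝ) * Real.log x ≤
      ∑ n ∈ roughFinset x y, Real.log n + x * ∑ n ∈ roughFinset x y, (n : ℝ)⁻¹ := by
    rw [Finset.mul_sum, ← Finset.sum_add_distrib, ← nsmul_eq_mul, ← Finset.sum_const]
    refine Finset.sum_le_sum fun n hn => ?_
    have hn : (0 : ℝ) < n := by exact_mod_cast (mem_roughFinset.1 hn).1.1
    have h1 := Real.log_le_self (x := x / n) (by positivity)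
    rw [Real.log_div hx.ne' hn.ne', div_eq_mul_inv] at h1
    linarith
  linarith [sum_log_roughFinset_le (y := y) hx.le]

theorem rough_numbers_count_bound :
    ∃ C : ℝ, 0 < C ∧ ∀ x y : ℝ, 1 < y → y ≤ x →
      (Phi x y : ℝ) ≤ C * x / Real.log y := by
  have h4 : 0 < Real.log 4 := Real.log_pos (by norm_num)
  have h2 := Real.log_two_gt_d9
  have h2' := Real.log_two_lt_d9
  refine ⟨4 * (Real.log 4 + 5), by positivity, fun x y hy hyx => ?_⟩
  have hly : 0 < Real.log y := Real.log_pos hy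
  have hx : 0 < x := by linarith
  change ((roughFinset x y).card : ℝ) ≤ _
  rw [le_div_iff₀ hly]
  rcases lt_or_ge y 2 with hy2 | hy2
  · have hc : ((roughFinset x y).card : ℝ) ≤ x := by
      have : (roughFinset x y).card ≤ ⌊x⌋₊ :=
        (Finset.card_filter_le _ _).trans (by simp)
      exact (Nat.cast_le.2 this).trans (Nat.floor_le hx.le)
    have hl : Real.log y ≤ Real.log 2 := Real.log_le_log (by linarith) hy2.le
    calc ((roughFinset x y).card : ℝ) * Real.log y ≤ x * (4 * (Real.log 4 + 5)) := by
          gcongr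
          linarith
      _ = _ := by ring
  · have hlx : Real.log 2 ≤ Real.log x := Real.log_le_log (by norm_num) (hy2.trans hyx)
    have hS := sum_inv_roughFinset_mul_log_le hy.le hyx
    refine le_of_mul_le_mul_right ?_ (show 0 < Real.log x by linarith)
    calc ((roughFinset x y).card : ℝ) * Real.log y * Real.log x
        = ((roughFinset x y).card : ℝ) * Real.log x * Real.log y := by ring
      _ ≤ (Real.log 4 + 5) * x * (∑ m ∈ roughFinset x y, (m : ℝ)⁻¹) * Real.log y := by
          exact mul_le_mul_of_nonneg_right (card_roughFinset_mul_log_le hx) hly.le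
      _ = (Real.log 4 + 5) * x * ((∑ m ∈ roughFinset x y, (m : ℝ)⁻¹) * Real.log y) := by ring
      _ ≤ (Real.log 4 + 5) * x * (4 * Real.log x) :=
          mul_le_mul_of_nonneg_left (by linarith) (by positivity)
      _ = 4 * (Real.log 4 + 5) * x * Real.log x := by ring
end

section
/- There exists an absolute constant C > 0 such that for all real x, y, u with x ≥ y² ≥ 1 and u ≥ 1, the number of positive integers n ≤ x having a divisor d > y all of whose prime factors are at most y^{1/u} is at most C·x·(e^{−u} + y^{−1/3}). -/
open scoped Classical

open Finset

/-- If the summatory function of `f` is at most `N * A` and `f` ignores factors `p`, then weighting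
`f n` by `r ^ n.factorization p` increases its sum by at most `N * A * (r - 1) / (p - r)`. -/
theorem sum_excess_le {f : ℕ → ℝ} {p : ℕ} {r A : ℝ} (hp : p.Prime) (hr : 1 ≤ r) (hrp : r < p)
    (hf : ∀ m, 0 < m → f (p * m) = f m) (hsum : ∀ N : ℕ, ∑ n ∈ Icc 1 N, f n ≤ N * A)
    (hA : 0 ≤ A) (N : ℕ) :
    ∑ n ∈ Icc 1 N, (r ^ n.factorization p - 1) * f n ≤ N * (A * ((r - 1) / (p - r))) := by
  have hp0 : (0 : ℝ) < p := by exact_mod_cast hp.pos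
  have hd : (0 : ℝ) < p - r := by linarith
  induction N using Nat.strong_induction_on with
  | _ N ih =>
  rcases Nat.eq_zero_or_pos N with rfl | hN
  · simp
  have hsub : ((Icc 1 (N / p)).image (p * ·)) ⊆ Icc 1 N := by
    intro n hn
    simp only [mem_image, mem_Icc] at hn ⊢
    obtain ⟨m, ⟨hm1, hm2⟩, rfl⟩ := hn
    exact ⟨Nat.mul_pos hp.pos hm1, (Nat.mul_le_mul_left p hm2).trans (Nat.mul_div_le N p)⟩
  rw [← sum_subset hsub]
  · rw [sum_image fun a _ b _ h => Nat.eq_of_mul_eq_mul_left hp.pos h]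
    have hterm : ∀ m ∈ Icc 1 (N / p),
        (r ^ (p * m).factorization p - 1) * f (p * m) =
          r * ((r ^ m.factorization p - 1) * f m) + (r - 1) * f m := by
      intro m hm
      have hm1 := (mem_Icc.1 hm).1
      rw [hf m hm1, Nat.factorization_mul hp.ne_zero (by omega)]
      simp [hp.factorization_self, pow_add]
      ring
    rw [sum_congr rfl hterm, sum_add_distrib, ← mul_sum, ← mul_sum]
    have h1 := ih (N / p) (Nat.div_lt_self hN hp.one_lt)
    have h2 := hsum (N / p)
    have h3 : ((N / p : ℕ) : ℝ) ≤ N / p := Nat.cast_div_le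
    have hB : 0 ≤ A * ((r - 1) / (p - r)) :=
      mul_nonneg hA (div_nonneg (by linarith) hd.le)
    calc _ ≤ r * (((N / p : ℕ) : ℝ) * (A * ((r - 1) / (p - r))))
          + (r - 1) * (((N / p : ℕ) : ℝ) * A) := by
            gcongr
      _ ≤ r * (((N / p : ℝ)) * (A * ((r - 1) / (p - r)))) + (r - 1) * ((N / p : ℝ) * A) := by
            gcongr
      _ = N * (A * ((r - 1) / (p - r))) := by
            field_simp
            ring
  · intro n hn hn'
    have : ¬ p ∣ n := by
      rintro ⟨m, rfl⟩
      have hn := mem_Icc.1 hn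
      exact hn' (mem_image.2 ⟨m, mem_Icc.2 ⟨Nat.pos_of_mul_pos_left hn.1,
        (Nat.le_div_iff_mul_le hp.pos).2 (by linarith [hn.2, mul_comm p m])⟩, rfl⟩)
    simp [Nat.factorization_eq_zero_of_not_dvd this]

theorem sum_prod_pow_factorization_le (r : ℕ → ℝ) (S : Finset ℕ) (hS : ∀ p ∈ S, p.Prime)
    (hr : ∀ p ∈ S, 1 ≤ r p) (hrp : ∀ p ∈ S, r p < p) (N : ℕ) :
    ∑ n ∈ Icc 1 N, ∏ p ∈ S, r p ^ n.factorization p ≤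
      N * ∏ p ∈ S, (1 + (r p - 1) / (p - r p)) := by
  induction S using Finset.induction_on generalizing N with
  | empty => simp
  | insert q S hq ih =>
    simp only [mem_insert, forall_eq_or_imp] at hS hr hrp
    have ih := ih hS.2 hr.2 hrp.2
    have hmul : ∀ m, 0 < m →
        ∏ p ∈ S, r p ^ (q * m).factorization p = ∏ p ∈ S, r p ^ m.factorization p := by
      intro m hm
      refine prod_congr rfl fun p hp => ?_
      have hne : p ≠ q := fun h => hq (h ▸ hp)
      rw [Nat.factorization_mul hS.1.ne_zero hm.ne']
      simp [hS.1.factorization, hne.symm]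
    have hA : 0 ≤ ∏ p ∈ S, (1 + (r p - 1) / (p - r p)) :=
      prod_nonneg fun p hp => add_nonneg zero_le_one
        (div_nonneg (by linarith [hr.2 p hp]) (by linarith [hrp.2 p hp]))
    have key := sum_excess_le hS.1 hr.1 hrp.1 hmul ih hA N
    have hsplit : ∑ n ∈ Icc 1 N, ∏ p ∈ insert q S, r p ^ n.factorization p =
        ∑ n ∈ Icc 1 N, ∏ p ∈ S, r p ^ n.factorization p +
        ∑ n ∈ Icc 1 N, (r q ^ n.factorization q - 1) * ∏ p ∈ S, r p ^ n.factorization p := by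
      rw [← sum_add_distrib]
      refine sum_congr rfl fun n _ => ?_
      rw [prod_insert hq]
      ring
    rw [hsplit, prod_insert hq]
    linarith [ih N]

theorem pow_div_dvd_factorial {p : ℕ} (hp : p.Prime) (n : ℕ) : p ^ (n / p) ∣ n.factorial := by
  refine dvd_trans ?_ (Nat.factorial_dvd_factorial (Nat.mul_div_le n p))
  rw [hp.pow_dvd_iff_le_factorization (Nat.factorial_ne_zero _),
    Nat.factorization_factorial_mul hp]
  omega

theorem sum_div_mul_log_le (n : ℕ) :
    ∑ p ∈ Ioc 0 n with p.Prime, ((n / p : ℕ) : ℝ) * Real.log p ≤ n * Real.log n := by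
  have hdvd : ∏ p ∈ Ioc 0 n with p.Prime, p ^ (n / p) ∣ n.factorial := by
    refine Finset.prod_dvd_of_isRelPrime ?_ fun p hp => pow_div_dvd_factorial (mem_filter.1 hp).2 n
    intro p hp q hq hpq
    have hp := (mem_filter.1 (mem_coe.1 hp)).2
    have hq := (mem_filter.1 (mem_coe.1 hq)).2
    exact Nat.coprime_iff_isRelPrime.1 (Nat.Coprime.pow _ _ ((Nat.coprime_primes hp hq).2 hpq))
  have hle := (Nat.le_of_dvd n.factorial_pos hdvd).trans n.factorial_le_pow
  have hpos : 0 < ∏ p ∈ Ioc 0 n with p.Prime, p ^ (n / p) :=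
    prod_pos fun p hp => pow_pos (mem_filter.1 hp).2.pos _
  have hlog := Real.log_le_log (by exact_mod_cast hpos) (Nat.cast_le (α := ℝ).2 hle)
  push_cast at hlog
  rw [Real.log_pow, Real.log_prod fun p hp =>
    pow_ne_zero _ (by exact_mod_cast (mem_filter.1 hp).2.ne_zero)] at hlog
  simpa [Real.log_pow] using hlog

/-- The upper bound in the first theorem of Mertens. -/
theorem sum_log_div_prime_le {z : ℝ} (hz : 1 ≤ z) :
    ∑ p ∈ Ioc 0 ⌊z⌋₊ with p.Prime, Real.log p / p ≤ Real.log z + Real.log 4 := by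
  set n := ⌊z⌋₊
  have hn1 : 1 ≤ n := Nat.one_le_floor_iff z |>.2 hz
  have hn0 : (0 : ℝ) < n := by exact_mod_cast hn1
  have htheta := Chebyshev.theta_le_log4_mul_x (x := (n : ℝ)) hn0.le
  rw [Chebyshev.theta, Nat.floor_natCast] at htheta
  have hmain : n * ∑ p ∈ Ioc 0 n with p.Prime, Real.log p / p ≤
      ∑ p ∈ Ioc 0 n with p.Prime, ((n / p : ℕ) : ℝ) * Real.log p +
        ∑ p ∈ Ioc 0 n with p.Prime, Real.log p := by
    rw [mul_sum, ← sum_add_distrib]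
    refine sum_le_sum fun p hp => ?_
    have hlog : 0 ≤ Real.log p := Real.log_natCast_nonneg p
    have hfl : (n : ℝ) / p ≤ ((n / p : ℕ) : ℝ) + 1 := by
      rw [← Nat.floor_div_eq_div (K := ℝ)]
      exact (Nat.lt_floor_add_one _).le
    calc n * (Real.log p / p) = n / p * Real.log p := by ring
      _ ≤ (((n / p : ℕ) : ℝ) + 1) * Real.log p := by gcongr
      _ = _ := by ring
  have hlogn : Real.log n ≤ Real.log z := Real.log_le_log hn0 (Nat.floor_le (by linarith))
  have hle : n * ∑ p ∈ Ioc 0 n with p.Prime, Real.log p / p ≤ n * (Real.log n + Real.log 4) := by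
    linarith [sum_div_mul_log_le n]
  linarith [le_of_mul_le_mul_left hle hn0]

theorem rpow_sub_one_div_le {p : ℕ} (hp : p.Prime) {β : ℝ} (hβ : 0 ≤ β) (hβ3 : β ≤ 1 / 3)
    (hlog : β * Real.log p ≤ 1) :
    (p : ℝ) ^ β < p ∧ ((p : ℝ) ^ β - 1) / (p - (p : ℝ) ^ β) ≤ 6 * β * (Real.log p / p) := by
  have hp2 : (2 : ℝ) ≤ p := by exact_mod_cast hp.two_le
  have hlog0 : 0 ≤ β * Real.log p := mul_nonneg hβ (Real.log_natCast_nonneg p)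
  have hbern : (p : ℝ) ^ β ≤ 2 / 3 * p := by
    have h := rpow_one_add_le_one_add_mul_self (s := (p : ℝ) - 1) (by linarith) hβ (by linarith)
    rw [add_sub_cancel] at h
    nlinarith
  have hexp : (p : ℝ) ^ β - 1 ≤ 2 * (β * Real.log p) := by
    have h := Real.abs_exp_sub_one_le (x := β * Real.log p) (by rwa [abs_of_nonneg hlog0])
    rw [abs_of_nonneg hlog0] at h
    rw [Real.rpow_def_of_pos (by linarith), mul_comm (Real.log p)]
    exact (le_abs_self _).trans h
  refine ⟨by linarith, ?_⟩
  calc ((p : ℝ) ^ β - 1) / (p - (p : ℝ) ^ β) ≤ 2 * (β * Real.log p) / (1 / 3 * p) := by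
        gcongr
        linarith
    _ = 6 * β * (Real.log p / p) := by
        field_simp
        ring

theorem prod_euler_factor_le {z β : ℝ} (hz : 1 ≤ z) (hβ : 0 ≤ β) (hβ3 : β ≤ 1 / 3)
    (hlog : β * Real.log z ≤ 1) :
    ∏ p ∈ Ioc 0 ⌊z⌋₊ with p.Prime, (1 + ((p : ℝ) ^ β - 1) / (p - (p : ℝ) ^ β)) ≤
      Real.exp 12 := by
  have hfac : ∀ p ∈ (Ioc 0 ⌊z⌋₊).filter Nat.Prime, (p : ℝ) ^ β < p ∧
      ((p : ℝ) ^ β - 1) / (p - (p : ℝ) ^ β) ≤ 6 * β * (Real.log p / p) := by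
    intro p hp
    rw [mem_filter, mem_Ioc] at hp
    have hpz : (p : ℝ) ≤ z := (Nat.le_floor_iff (by linarith)).1 hp.1.2
    refine rpow_sub_one_div_le hp.2 hβ hβ3 (le_trans ?_ hlog)
    gcongr
    exact_mod_cast hp.1.1
  have hlog4 : Real.log 4 ≤ 3 := by
    linarith [Real.log_le_sub_one_of_pos (show (0 : ℝ) < 4 by norm_num)]
  calc _ ≤ ∏ p ∈ Ioc 0 ⌊z⌋₊ with p.Prime, Real.exp (6 * β * (Real.log p / p)) := by
        refine prod_le_prod (fun p hp => ?_) fun p hp => ?_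
        · have h1 : 1 ≤ (p : ℝ) ^ β :=
            Real.one_le_rpow (by exact_mod_cast (mem_filter.1 hp).2.one_le) hβ
          exact add_nonneg zero_le_one
            (div_nonneg (by linarith) (by linarith [(hfac p hp).1]))
        · linarith [(hfac p hp).2, Real.add_one_le_exp (6 * β * (Real.log p / p))]
    _ = Real.exp (6 * β * ∑ p ∈ Ioc 0 ⌊z⌋₊ with p.Prime, Real.log p / p) := by
        rw [← Real.exp_sum, mul_sum]
    _ ≤ Real.exp 12 := by
        gcongr
        have h := mul_le_mul_of_nonneg_left (sum_log_div_prime_le hz) hβ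
        nlinarith

theorem rpow_le_prod_of_smooth_dvd {S : Finset ℕ} {d n : ℕ} (hn : n ≠ 0) (hd : d ∣ n)
    (hS : ∀ p : ℕ, p.Prime → p ∣ d → p ∈ S) (hSp : ∀ p ∈ S, p.Prime) {β : ℝ} (hβ : 0 ≤ β) :
    (d : ℝ) ^ β ≤ ∏ p ∈ S, ((p : ℝ) ^ β) ^ n.factorization p := by
  have hd0 : d ≠ 0 := ne_zero_of_dvd_ne_zero hn hd
  have hdprod : d = ∏ p ∈ S, p ^ d.factorization p := by
    conv_lhs => rw [← Nat.prod_factorization_pow_eq_self hd0]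
    refine Finsupp.prod_of_support_subset _ (fun p hp => ?_) _ (by simp)
    have hp : p ∈ d.primeFactors := hp
    exact hS p (Nat.prime_of_mem_primeFactors hp) (Nat.dvd_of_mem_primeFactors hp)
  calc (d : ℝ) ^ β = (∏ p ∈ S, (p : ℝ) ^ d.factorization p) ^ β := by
        conv_lhs => rw [hdprod]
        push_cast
        rfl
    _ = ∏ p ∈ S, ((p : ℝ) ^ β) ^ d.factorization p := by
        rw [← Real.finsetProd_rpow _ _ fun p _ => by positivity]
        refine prod_congr rfl fun p _ => ?_
        rw [← Real.rpow_natCast, ← Real.rpow_natCast, ← Real.rpow_mul (by positivity),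
          ← Real.rpow_mul (by positivity), mul_comm]
    _ ≤ _ := by
        refine prod_le_prod (fun p _ => by positivity) fun p hp => ?_
        exact pow_le_pow_right₀ (Real.one_le_rpow (by exact_mod_cast (hSp p hp).one_le) hβ)
          ((Nat.factorization_le_iff_dvd hd0 hn).2 hd p)

/-- Rankin's bound for the number of integers up to `x` with a large `z`-smooth divisor. -/
theorem card_smooth_divisor_le {x y z β : ℝ} (hx : 0 ≤ x) (hy : 0 < y) (hz : 1 ≤ z)
    (hβ : 0 ≤ β) (hβ3 : β ≤ 1 / 3) (hlog : β * Real.log z ≤ 1) :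
    (((Icc 1 ⌊x⌋₊).filter (fun n => ∃ d : ℕ, d ∣ n ∧ y < (d : ℝ) ∧
        ∀ p : ℕ, p.Prime → p ∣ d → (p : ℝ) ≤ z)).card : ℝ) ≤
      Real.exp 12 * x * y ^ (-β) := by
  set S := (Ioc 0 ⌊z⌋₊).filter Nat.Prime
  have hSp : ∀ p ∈ S, p.Prime := fun p hp => (mem_filter.1 hp).2
  have hSone : ∀ p ∈ S, 1 ≤ (p : ℝ) ^ β := fun p hp =>
    Real.one_le_rpow (by exact_mod_cast (hSp p hp).one_le) hβ
  have hSlt : ∀ p ∈ S, (p : ℝ) ^ β < p := fun p hp => by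
    have h1 : (1 : ℝ) < p := by exact_mod_cast (hSp p hp).one_lt
    simpa using Real.rpow_lt_rpow_of_exponent_lt h1 (show β < 1 by linarith)
  have hyβ : 0 < y ^ β := Real.rpow_pos_of_pos hy β
  set T := (Icc 1 ⌊x⌋₊).filter (fun n => ∃ d : ℕ, d ∣ n ∧ y < (d : ℝ) ∧
    ∀ p : ℕ, p.Prime → p ∣ d → (p : ℝ) ≤ z)
  have hcount : (T.card : ℝ) * y ^ β ≤ Real.exp 12 * x :=
    calc (T.card : ℝ) * y ^ β = ∑ n ∈ T, y ^ β := by simp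
      _ ≤ ∑ n ∈ T, ∏ p ∈ S, ((p : ℝ) ^ β) ^ n.factorization p := by
          refine sum_le_sum fun n hn => ?_
          obtain ⟨hn, d, hdn, hyd, hd⟩ := mem_filter.1 hn
          refine (Real.rpow_le_rpow hy.le hyd.le hβ).trans
            (rpow_le_prod_of_smooth_dvd (by have := (mem_Icc.1 hn).1; omega) hdn
              (fun p hp hpd => ?_) hSp hβ)
          exact mem_filter.2 ⟨mem_Ioc.2 ⟨hp.pos, Nat.le_floor (hd p hp hpd)⟩, hp⟩
      _ ≤ ∑ n ∈ Icc 1 ⌊x⌋₊, ∏ p ∈ S, ((p : ℝ) ^ β) ^ n.factorization p :=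
          sum_le_sum_of_subset_of_nonneg (filter_subset _ _) fun n _ _ => by positivity
      _ ≤ ⌊x⌋₊ * ∏ p ∈ S, (1 + ((p : ℝ) ^ β - 1) / (p - (p : ℝ) ^ β)) :=
          sum_prod_pow_factorization_le (fun p => (p : ℝ) ^ β) S hSp hSone hSlt _
      _ ≤ ⌊x⌋₊ * Real.exp 12 := by
          gcongr
          exact prod_euler_factor_le hz hβ hβ3 hlog
      _ ≤ x * Real.exp 12 := by
          gcongr
          exact Nat.floor_le hx
      _ = Real.exp 12 * x := mul_comm _ _
  rw [Real.rpow_neg hy.le, ← div_eq_mul_inv, le_div_iff₀ hyβ]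
  exact hcount

theorem smooth_divisor_count_bound :
    ∃ C : ℝ, 0 < C ∧ ∀ x y u : ℝ, 1 ≤ y → y ^ 2 ≤ x → 1 ≤ u →
      (((Finset.Icc 1 ⌊x⌋₊).filter
          (fun n => ∃ d : ℕ, d ∣ n ∧ y < (d : ℝ) ∧
            ∀ p : ℕ, p.Prime → p ∣ d → (p : ℝ) ≤ y ^ ((1 : ℝ) / u))).card : ℝ)
        ≤ C * x * (Real.exp (-u) + y ^ (-(1 : ℝ) / 3)) := by
  refine ⟨Real.exp 12, Real.exp_pos _, fun x y u hy hxy hu => ?_⟩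
  have hy0 : 0 < y := by linarith
  have hx : 0 ≤ x := (sq_nonneg y).trans hxy
  have hu0 : 0 < u := by linarith
  have hz : 1 ≤ y ^ ((1 : ℝ) / u) := Real.one_le_rpow hy (by positivity)
  have hlogz : Real.log (y ^ ((1 : ℝ) / u)) = Real.log y / u := by
    rw [Real.log_rpow hy0]
    ring
  have hlogy : 0 ≤ Real.log y := Real.log_nonneg hy
  rcases le_or_gt (Real.log y) (3 * u) with h | h
  · refine (card_smooth_divisor_le (β := 1 / 3) hx hy0 hz (by norm_num) le_rfl ?_).trans ?_
    · rw [hlogz, ← mul_div_assoc, div_le_one hu0]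
      linarith
    · rw [neg_div]
      gcongr
      linarith [Real.exp_pos (-u)]
  · have hlogy0 : 0 < Real.log y := by linarith
    refine (card_smooth_divisor_le (β := u / Real.log y) hx hy0 hz (by positivity) ?_ ?_).trans ?_
    · rw [div_le_div_iff₀ hlogy0 (by norm_num)]
      linarith
    · rw [hlogz]
      exact le_of_eq (by field_simp)
    · have hexp : y ^ (-(u / Real.log y)) = Real.exp (-u) := by
        rw [Real.rpow_def_of_pos hy0]
        congr 1
        field_simp
      rw [hexp]
      gcongr
      linarith [Real.rpow_pos_of_pos hy0 (-(1 : ℝ) / 3)]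
end

section
/- Let Q(λ) = λ·log λ − λ + 1 for λ > 0 and Q(0) = 0. There exists an absolute constant C > 0 such that for all y ≥ 2 and all λ with 0 ≤ λ ≤ 1: the product over primes p ≤ y of (1 − 1/p), multiplied by the sum of 1/m over all positive integers m that are y-smooth and satisfy Ω(m) ≤ λ·log log y, is at most C·(log y)^{−Q(λ)}. -/
open scoped Classical

/-- `Q λ = λ log λ − λ + 1` for `λ > 0`, and `Q 0 = 0`. -/
noncomputable def Q (l : ℝ) : ℝ := if l = 0 then 0 else l * Real.log l - l + 1

section

open ArithmeticFunction Finset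

/-- The completely multiplicative function `n ↦ z ^ Ω(n) / n`. -/
noncomputable def powCardFactorsDiv (z : ℝ) : ℕ →* ℝ where
  toFun n := z ^ cardFactors n / n
  map_one' := by simp
  map_mul' m n := by
    rcases eq_or_ne m 0 with rfl | hm
    · simp
    rcases eq_or_ne n 0 with rfl | hn
    · simp
    rw [cardFactors_mul hm hn, pow_add, Nat.cast_mul, mul_div_mul_comm]

lemma powCardFactorsDiv_apply (z : ℝ) (n : ℕ) :
    powCardFactorsDiv z n = z ^ cardFactors n / n := rfl

lemma powCardFactorsDiv_apply_prime (z : ℝ) {p : ℕ} (hp : p.Prime) :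
    powCardFactorsDiv z p = z / p := by
  rw [powCardFactorsDiv_apply, cardFactors_apply_prime hp, pow_one]

lemma powCardFactorsDiv_nonneg {z : ℝ} (hz : 0 ≤ z) (n : ℕ) : 0 ≤ powCardFactorsDiv z n := by
  rw [powCardFactorsDiv_apply]
  positivity

lemma hasSum_indicator_powCardFactorsDiv {z : ℝ} (hz : 0 ≤ z) (hz1 : z ≤ 1) (s : Finset ℕ) :
    HasSum ((Nat.factoredNumbers s).indicator (powCardFactorsDiv z))
      (∏ p ∈ s with p.Prime, (1 - z / p)⁻¹) := by
  have hlt {p : ℕ} (hp : p.Prime) : ‖powCardFactorsDiv z p‖ < 1 := by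
    have hp1 : (1 : ℝ) < p := by exact_mod_cast hp.one_lt
    rw [Real.norm_of_nonneg (powCardFactorsDiv_nonneg hz p), powCardFactorsDiv_apply_prime z hp,
      div_lt_one (by linarith)]
    linarith
  have h :=
    (EulerProduct.summable_and_hasSum_factoredNumbers_prod_filter_prime_geometric hlt s).2
  have hprod : ∏ p ∈ s with p.Prime, (1 - powCardFactorsDiv z p)⁻¹ =
      ∏ p ∈ s with p.Prime, (1 - z / p)⁻¹ :=
    prod_congr rfl fun p hp ↦ by rw [powCardFactorsDiv_apply_prime z (mem_filter.mp hp).2]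
  rw [hprod] at h
  exact hasSum_subtype_iff_indicator.mp h

lemma one_sub_div_prime_pos {z : ℝ} (hz1 : z ≤ 1) {p : ℕ} (hp : p.Prime) :
    0 < 1 - z / (p : ℝ) := by
  have hp1 : (1 : ℝ) < p := by exact_mod_cast hp.one_lt
  rw [sub_pos, div_lt_one (by linarith)]
  linarith

/-- The upper bound in Mertens' third theorem, up to a constant. -/
lemma prod_one_sub_inv_prime_le {y : ℝ} (hy : 1 < y) :
    ∏ p ∈ (Icc 1 ⌊y⌋₊).filter Nat.Prime, (1 - 1 / (p : ℝ)) ≤ (Real.log y)⁻¹ := by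
  have hlog : 0 < Real.log y := Real.log_pos hy
  have h := hasSum_indicator_powCardFactorsDiv zero_le_one le_rfl (Icc 1 ⌊y⌋₊)
  have hle : Real.log y ≤ ∏ p ∈ (Icc 1 ⌊y⌋₊).filter Nat.Prime, (1 - 1 / (p : ℝ))⁻¹ := by
    calc Real.log y ≤ harmonic ⌊y⌋₊ := log_le_harmonic_floor y (by linarith)
      _ = ∑ n ∈ Icc 1 ⌊y⌋₊, (n : ℝ)⁻¹ := by rw [harmonic_eq_sum_Icc]; push_cast; rfl
      _ = ∑ n ∈ Icc 1 ⌊y⌋₊,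
          (Nat.factoredNumbers (Icc 1 ⌊y⌋₊)).indicator (powCardFactorsDiv 1) n := by
        refine sum_congr rfl fun n hn ↦ ?_
        rw [mem_Icc] at hn
        rw [Set.indicator_of_mem, powCardFactorsDiv_apply, one_pow, one_div]
        refine ⟨by omega, fun p hp ↦ mem_Icc.mpr ⟨?_, ?_⟩⟩
        · exact (Nat.prime_of_mem_primeFactorsList hp).one_lt.le
        · exact (Nat.le_of_mem_primeFactorsList hp).trans hn.2
      _ ≤ _ := sum_le_hasSum _
        (fun n _ ↦ Set.indicator_nonneg (fun n _ ↦ powCardFactorsDiv_nonneg zero_le_one n) n) h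
  rw [prod_inv_distrib] at hle
  exact (le_inv_comm₀ hlog (prod_pos fun p hp ↦
    one_sub_div_prime_pos le_rfl (mem_filter.mp hp).2)).mp hle

/-- Weighted AM-GM for the Euler factors. -/
lemma one_sub_div_mul_inv_le_rpow {z : ℝ} (hz : 0 ≤ z) (hz1 : z ≤ 1) {p : ℕ} (hp : p.Prime) :
    (1 - 1 / (p : ℝ)) * (1 - z / p)⁻¹ ≤ (1 - 1 / (p : ℝ)) ^ (1 - z) := by
  have hpos := one_sub_div_prime_pos le_rfl hp
  have hposz := one_sub_div_prime_pos hz1 hp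
  have amgm := Real.geom_mean_le_arith_mean2_weighted hz (sub_nonneg.mpr hz1) hpos.le zero_le_one
    (by ring)
  rw [Real.one_rpow, mul_one] at amgm
  rw [← div_eq_mul_inv, div_le_iff₀ hposz]
  calc 1 - 1 / (p : ℝ) = (1 - 1 / (p : ℝ)) ^ (1 - z) * (1 - 1 / (p : ℝ)) ^ z := by
        rw [← Real.rpow_add hpos, sub_add_cancel, Real.rpow_one]
    _ ≤ (1 - 1 / (p : ℝ)) ^ (1 - z) * (1 - z / p) := by
        refine mul_le_mul_of_nonneg_left (amgm.trans_eq (by ring)) ?_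
        exact Real.rpow_nonneg hpos.le _

lemma prod_one_sub_mul_prod_inv_le {y z : ℝ} (hy : 1 < y) (hz : 0 ≤ z) (hz1 : z ≤ 1) :
    (∏ p ∈ (Icc 1 ⌊y⌋₊).filter Nat.Prime, (1 - 1 / (p : ℝ))) *
      ∏ p ∈ (Icc 1 ⌊y⌋₊).filter Nat.Prime, (1 - z / (p : ℝ))⁻¹ ≤ Real.log y ^ (z - 1) := by
  have hpos {p : ℕ} (hp : p ∈ (Icc 1 ⌊y⌋₊).filter Nat.Prime) : 0 < 1 - 1 / (p : ℝ) :=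
    one_sub_div_prime_pos le_rfl (mem_filter.mp hp).2
  rw [← prod_mul_distrib]
  calc _ ≤ ∏ p ∈ (Icc 1 ⌊y⌋₊).filter Nat.Prime, (1 - 1 / (p : ℝ)) ^ (1 - z) :=
        prod_le_prod
          (fun p hp ↦ mul_nonneg (hpos hp).le
            (inv_nonneg.mpr (one_sub_div_prime_pos hz1 (mem_filter.mp hp).2).le))
          (fun p hp ↦ one_sub_div_mul_inv_le_rpow hz hz1 (mem_filter.mp hp).2)
    _ = (∏ p ∈ (Icc 1 ⌊y⌋₊).filter Nat.Prime, (1 - 1 / (p : ℝ))) ^ (1 - z) :=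
        Real.finsetProd_rpow _ _ (fun p hp ↦ (hpos hp).le) _
    _ ≤ (Real.log y)⁻¹ ^ (1 - z) :=
        Real.rpow_le_rpow (prod_nonneg fun p hp ↦ (hpos hp).le) (prod_one_sub_inv_prime_le hy)
          (sub_nonneg.mpr hz1)
    _ = Real.log y ^ (z - 1) := by
        rw [Real.inv_rpow (Real.log_pos hy).le, ← Real.rpow_neg (Real.log_pos hy).le, neg_sub]

lemma one_le_pow_mul_rpow_neg {l t : ℝ} {n : ℕ} (hl : 0 ≤ l) (hl1 : l ≤ 1) (hn : n ≤ l * t) :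
    1 ≤ l ^ n * l ^ (-(l * t)) := by
  rcases hl.eq_or_lt with rfl | hl0
  · have : n = 0 := by
      rw [zero_mul] at hn
      exact_mod_cast hn.antisymm n.cast_nonneg
    simp [this]
  · rw [← Real.rpow_natCast, ← Real.rpow_add hl0]
    exact Real.one_le_rpow_of_pos_of_le_one_of_nonpos hl0 hl1 (by linarith)

/-- Rankin's trick. -/
lemma tsum_smooth_few_prime_factors_le {y l : ℝ} (t : ℝ) (hl : 0 ≤ l) (hl1 : l ≤ 1) :
    (∑' m : ℕ,
      if 1 ≤ m ∧ (∀ p : ℕ, p.Prime → p ∣ m → (p : ℝ) ≤ y) ∧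
          (m.primeFactorsList.length : ℝ) ≤ l * t
      then 1 / (m : ℝ) else 0) ≤
    l ^ (-(l * t)) * ∏ p ∈ (Icc 1 ⌊y⌋₊).filter Nat.Prime, (1 - l / (p : ℝ))⁻¹ := by
  have h := (hasSum_indicator_powCardFactorsDiv hl hl1 (Icc 1 ⌊y⌋₊)).mul_left (l ^ (-(l * t)))
  have hnn (m : ℕ) : 0 ≤
      l ^ (-(l * t)) * (Nat.factoredNumbers (Icc 1 ⌊y⌋₊)).indicator (powCardFactorsDiv l) m :=
    mul_nonneg (Real.rpow_nonneg hl _)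
      (Set.indicator_nonneg (fun n _ ↦ powCardFactorsDiv_nonneg hl n) m)
  have hle (m : ℕ) :
      (if 1 ≤ m ∧ (∀ p : ℕ, p.Prime → p ∣ m → (p : ℝ) ≤ y) ∧
          (m.primeFactorsList.length : ℝ) ≤ l * t
        then 1 / (m : ℝ) else 0) ≤
      l ^ (-(l * t)) * (Nat.factoredNumbers (Icc 1 ⌊y⌋₊)).indicator (powCardFactorsDiv l) m := by
    split_ifs with hm
    · obtain ⟨hm1, hmy, hmt⟩ := hm
      have hmem : m ∈ Nat.factoredNumbers (Icc 1 ⌊y⌋₊) := by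
        refine ⟨by omega, fun p hp ↦ mem_Icc.mpr ⟨?_, Nat.le_floor ?_⟩⟩
        · exact (Nat.prime_of_mem_primeFactorsList hp).one_lt.le
        · exact hmy p (Nat.prime_of_mem_primeFactorsList hp) (Nat.dvd_of_mem_primeFactorsList hp)
      rw [Set.indicator_of_mem hmem, powCardFactorsDiv_apply, ← mul_div_assoc, mul_comm]
      gcongr
      exact one_le_pow_mul_rpow_neg hl hl1 hmt
    · exact hnn m
  rw [← h.tsum_eq]
  refine Summable.tsum_le_tsum hle (.of_nonneg_of_le (fun m ↦ ?_) hle h.summable) h.summable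
  split_ifs <;> positivity

end

theorem smooth_few_prime_factors_sum_bound :
    ∃ C : ℝ, 0 < C ∧ ∀ y l : ℝ, 2 ≤ y → 0 ≤ l → l ≤ 1 →
      (∏ p ∈ (Finset.Icc 1 ⌊y⌋₊).filter Nat.Prime, (1 - 1 / (p : ℝ))) *
        (∑' m : ℕ,
          if 1 ≤ m ∧ (∀ p : ℕ, p.Prime → p ∣ m → (p : ℝ) ≤ y) ∧
              (m.primeFactorsList.length : ℝ) ≤ l * Real.log (Real.log y)
          then 1 / (m : ℝ) else 0)
      ≤ C * Real.log y ^ (-Q l) := by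
  have hlog2 : 0 < Real.log 2 := Real.log_pos one_lt_two
  have hC : 1 ≤ (Real.log 2)⁻¹ := (one_le_inv₀ hlog2).mpr (by linarith [Real.log_two_lt_d9])
  refine ⟨(Real.log 2)⁻¹, inv_pos.mpr hlog2, fun y l hy hl hl1 ↦ ?_⟩
  have hlogy : Real.log 2 ≤ Real.log y := Real.log_le_log two_pos hy
  have hlog : 0 < Real.log y := hlog2.trans_le hlogy
  have hprod : 0 ≤ ∏ p ∈ (Finset.Icc 1 ⌊y⌋₊).filter Nat.Prime, (1 - 1 / (p : ℝ)) :=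
    Finset.prod_nonneg fun p hp ↦
      (one_sub_div_prime_pos le_rfl (Finset.mem_filter.mp hp).2).le
  refine (mul_le_mul_of_nonneg_left
    (tsum_smooth_few_prime_factors_le (Real.log (Real.log y)) hl hl1) hprod).trans ?_
  rw [mul_left_comm]
  refine (mul_le_mul_of_nonneg_left (prod_one_sub_mul_prod_inv_le (by linarith) hl hl1)
    (Real.rpow_nonneg hl _)).trans ?_
  rcases hl.eq_or_lt with rfl | hl0
  · simpa [Q, Real.rpow_neg_one] using inv_anti₀ hlog2 hlogy
  · have hexp : l ^ (-(l * Real.log (Real.log y))) * Real.log y ^ (l - 1) =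
        Real.log y ^ (-Q l) := by
      rw [Q, if_neg hl0.ne', Real.rpow_def_of_pos hl0, Real.rpow_def_of_pos hlog,
        Real.rpow_def_of_pos hlog, ← Real.exp_add]
      ring_nf
    rw [hexp]
    exact le_mul_of_one_le_left (Real.rpow_nonneg hlog.le _) hC
end

section
/- For every real α with 0 < α < 1, every ε > 0, and every real number c with α < c ≤ 1, and for every real y ≥ 2, there exists a set P of prime numbers all exceeding y such that ∑_{p∈P} 1/p < ∞ and c · ∏_{p∈P}(1 − 1/p) = α. -/
open Filter Topology in
/-- Greedy selection: if the nonnegative terms `f n`, `n ∈ A`, tend to zero and have a divergent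
sum, then every `T ≥ 0` is the sum of `f` over some subset of `A`. -/
theorem exists_subset_hasSum_indicator {f : ℕ → ℝ} {A : Set ℕ} (hf : ∀ n, 0 ≤ f n)
    (hlim : Tendsto f atTop (𝓝 0)) (hA : ¬ Summable (A.indicator f)) {T : ℝ} (hT : 0 ≤ T) :
    ∃ S ⊆ A, HasSum (S.indicator f) T := by
  classical
  let s : ℕ → ℝ := fun n ↦
    Nat.rec 0 (fun n a ↦ if n ∈ A ∧ a + f n ≤ T then a + f n else a) n
  have hs (n : ℕ) : s (n + 1) = if n ∈ A ∧ s n + f n ≤ T then s n + f n else s n := rfl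
  let S : Set ℕ := {n | n ∈ A ∧ s n + f n ≤ T}
  have hsum (n : ℕ) : ∑ i ∈ Finset.range n, S.indicator f i = s n := by
    induction n with
    | zero => rfl
    | succ n ih =>
      rw [Finset.sum_range_succ, ih, hs, Set.indicator_apply]
      simp only [S, Set.mem_ofPred_eq]
      split_ifs <;> simp
  have hsT (n : ℕ) : s n ≤ T := by
    induction n with
    | zero => exact hT
    | succ n ih =>
      rw [hs]
      split_ifs with h
      exacts [h.2, ih]
  have hS : Summable (S.indicator f) :=
    summable_of_sum_range_le (Set.indicator_nonneg fun n _ ↦ hf n)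
      fun n ↦ (hsum n).trans_le (hsT n)
  have htend : Tendsto s atTop (𝓝 (∑' n, S.indicator f n)) := by
    simpa only [hsum] using hS.hasSum.tendsto_sum_nat
  have hfreq : ∃ᶠ n in atTop, T ≤ s n + f n := by
    refine fun hev ↦ hA ((summable_congr_cofinite ?_).mpr hS)
    rw [Nat.cofinite_eq_atTop]
    filter_upwards [hev] with n hn
    by_cases hnA : n ∈ A
    · have hnS : n ∈ S := ⟨hnA, (not_le.mp hn).le⟩
      simp [hnA, hnS]
    · have hnS : n ∉ S := fun h ↦ hnA h.1
      simp [hnA, hnS]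
  have hle : ∑' n, S.indicator f n ≤ T := le_of_tendsto' htend hsT
  have hge : T ≤ ∑' n, S.indicator f n := by
    have h := htend.add hlim
    rw [add_zero] at h
    exact ge_of_tendsto_of_frequently h hfreq
  exact ⟨S, fun _ h ↦ h.1, le_antisymm hle hge ▸ hS.hasSum⟩

theorem one_div_le_neg_log_one_sub_one_div {n : ℕ} (hn : 1 < n) :
    1 / (n : ℝ) ≤ -Real.log (1 - 1 / (n : ℝ)) := by
  have hn' : (1 : ℝ) < n := mod_cast hn
  have h : 1 / (n : ℝ) < 1 := by rw [div_lt_one] <;> linarith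
  linarith [Real.log_le_sub_one_of_pos (sub_pos.mpr h)]

theorem neg_log_one_sub_one_div_nonneg (n : ℕ) : 0 ≤ -Real.log (1 - 1 / (n : ℝ)) := by
  rcases Nat.lt_or_ge 1 n with hn | hn
  · exact le_trans (by positivity) (one_div_le_neg_log_one_sub_one_div hn)
  · interval_cases n <;> simp

open Filter Topology in
theorem tendsto_neg_log_one_sub_one_div :
    Tendsto (fun n : ℕ ↦ -Real.log (1 - 1 / (n : ℝ))) atTop (𝓝 0) := by
  have h : Tendsto (fun n : ℕ ↦ 1 - 1 / (n : ℝ)) atTop (𝓝 1) := by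
    simpa using tendsto_one_div_atTop_nhds_zero_nat.const_sub (1 : ℝ)
  simpa using (h.log one_ne_zero).neg

theorem not_summable_neg_log_one_sub_one_div_on_primes_gt (y : ℝ) :
    ¬ Summable ({p : ℕ | p.Prime ∧ y < p}.indicator
      fun n : ℕ ↦ -Real.log (1 - 1 / (n : ℝ))) := by
  intro h
  have h' : Summable ({p : ℕ | p.Prime ∧ y < p}.indicator fun n : ℕ ↦ 1 / (n : ℝ)) := by
    refine h.of_nonneg_of_le (Set.indicator_nonneg fun n _ ↦ by positivity) fun n ↦ ?_
    by_cases hn : n ∈ {p : ℕ | p.Prime ∧ y < p}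
    · simpa only [Set.indicator_of_mem hn] using one_div_le_neg_log_one_sub_one_div hn.1.one_lt
    · simp only [Set.indicator_of_notMem hn, le_refl]
  refine not_summable_one_div_on_primes ((summable_congr_cofinite ?_).mpr h')
  rw [Nat.cofinite_eq_atTop]
  filter_upwards [tendsto_natCast_atTop_atTop.eventually_gt_atTop y] with n hn
  simp [Set.indicator_apply, hn]

theorem exists_prime_set_with_prescribed_product
    (α : ℝ) (hα0 : 0 < α) (hα1 : α < 1)
    (ε : ℝ) (hε : 0 < ε)
    (c : ℝ) (hc0 : α < c) (hc1 : c ≤ 1)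
    (y : ℝ) (hy : 2 ≤ y) :
    ∃ P : Set ℕ, (∀ p ∈ P, p.Prime ∧ y < (p : ℝ)) ∧
      Summable (fun p : P => 1 / (p : ℝ)) ∧
      c * ∏' p : P, (1 - 1 / (p : ℝ)) = α := by
  have hc : 0 < c := hα0.trans hc0
  obtain ⟨P, hP, hsum⟩ := exists_subset_hasSum_indicator neg_log_one_sub_one_div_nonneg
    tendsto_neg_log_one_sub_one_div (not_summable_neg_log_one_sub_one_div_on_primes_gt y)
    (Real.log_nonneg ((one_le_div hα0).mpr hc0.le))
  replace hsum := hasSum_subtype_iff_indicator.mpr hsum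
  refine ⟨P, fun p hp ↦ hP hp, hsum.summable.of_nonneg_of_le (fun _ ↦ by positivity)
    fun p ↦ one_div_le_neg_log_one_sub_one_div (hP p.2).1.one_lt, ?_⟩
  have hexp (p : P) : Real.exp (Real.log (1 - 1 / (p : ℝ))) = 1 - 1 / (p : ℝ) := by
    have hp : (1 : ℝ) < (p : ℕ) := mod_cast (hP p.2).1.one_lt
    refine Real.exp_log (sub_pos.mpr ?_)
    rw [div_lt_one] <;> linarith
  have hprod : HasProd (fun p : P ↦ 1 - 1 / (p : ℝ)) (Real.exp (-Real.log (c / α))) := by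
    simpa only [Function.comp_def, neg_neg, hexp] using hsum.neg.rexp
  rw [hprod.tprod_eq, Real.exp_neg, Real.exp_log (div_pos hc hα0)]
  field_simp
end

section
/- Let 0 < a < 1 be fixed and let A, B be sets of positive integers such that #{n ≤ x : n ∉ A} ≪ x·(log x)^{−a} and #{n ≤ x : n ∉ B} ≪ x·(log x)^{−a} for all x ≥ 2. Then for every ε > 0, #{n ≤ x : n ∉ A·B} ≪_ε x·(log x)^{−a²/(1+a)+ε} for all x ≥ 2. -/
open Pointwise
open scoped Classical

/-- All prime factors of `n` are less than `y`. -/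
def IsSmooth (y : ℝ) (n : ℕ) : Prop := ∀ p : ℕ, p.Prime → p ∣ n → (p : ℝ) < y

/-- All prime factors of `n` are at least `y`. -/
def IsRough (y : ℝ) (n : ℕ) : Prop := ∀ p : ℕ, p.Prime → p ∣ n → y ≤ (p : ℝ)

theorem IsSmooth.of_dvd {y : ℝ} {m n : ℕ} (h : IsSmooth y n) (hmn : m ∣ n) : IsSmooth y m :=
  fun p hp hpm => h p hp (hpm.trans hmn)

theorem IsRough.of_dvd {y : ℝ} {m n : ℕ} (h : IsRough y n) (hmn : m ∣ n) : IsRough y m :=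
  fun p hp hpm => h p hp (hpm.trans hmn)

theorem IsSmooth.coprime {y : ℝ} {m n : ℕ} (hm : IsSmooth y m) (hn : IsRough y n) :
    m.Coprime n :=
  Nat.coprime_of_dvd fun p hp hpm hpn => absurd (hm p hp hpm) (not_lt.2 (hn p hp hpn))

theorem IsSmooth.mul {y : ℝ} {m n : ℕ} (hm : IsSmooth y m) (hn : IsSmooth y n) :
    IsSmooth y (m * n) :=
  fun p hp h => ((hp.dvd_mul).1 h).elim (hm p hp) (hn p hp)

theorem IsRough.mul {y : ℝ} {m n : ℕ} (hm : IsRough y m) (hn : IsRough y n) :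
    IsRough y (m * n) :=
  fun p hp h => ((hp.dvd_mul).1 h).elim (hm p hp) (hn p hp)

theorem isSmooth_one (y : ℝ) : IsSmooth y 1 :=
  fun _ hp h => absurd (Nat.dvd_one.1 h) hp.ne_one

theorem isRough_one (y : ℝ) : IsRough y 1 :=
  fun _ hp h => absurd (Nat.dvd_one.1 h) hp.ne_one

theorem exists_isSmooth_mul_isRough (y : ℝ) {n : ℕ} (hn : n ≠ 0) :
    ∃ s r : ℕ, IsSmooth y s ∧ IsRough y r ∧ s * r = n := by
  induction n using Nat.recOnMul with
  | zero => exact absurd rfl hn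
  | one => exact ⟨1, 1, isSmooth_one y, isRough_one y, rfl⟩
  | prime p hp =>
    rcases lt_or_ge (p : ℝ) y with h | h
    · refine ⟨p, 1, fun q hq hqp => ?_, isRough_one y, mul_one p⟩
      rwa [(Nat.prime_dvd_prime_iff_eq hq hp).1 hqp]
    · refine ⟨1, p, isSmooth_one y, fun q hq hqp => ?_, one_mul p⟩
      rwa [(Nat.prime_dvd_prime_iff_eq hq hp).1 hqp]
  | mul m n ihm ihn =>
    obtain ⟨s, r, hs, hr, rfl⟩ := ihm (left_ne_zero_of_mul hn)
    obtain ⟨s', r', hs', hr', rfl⟩ := ihn (right_ne_zero_of_mul hn)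
    exact ⟨s * s', r * r', hs.mul hs', hr.mul hr', by ring⟩

theorem eq_and_eq_of_isSmooth_mul_isRough {y : ℝ} {s r s' r' : ℕ} (hs : IsSmooth y s)
    (hr : IsRough y r) (hs' : IsSmooth y s') (hr' : IsRough y r') (hs0 : s ≠ 0)
    (h : s * r = s' * r') : s = s' ∧ r = r' := by
  have h1 : s ∣ s' := (hs.coprime hr').dvd_of_dvd_mul_right (h ▸ dvd_mul_right s r)
  have h2 : s' ∣ s := (hs'.coprime hr).dvd_of_dvd_mul_right (h ▸ dvd_mul_right s' r')
  obtain rfl := Nat.dvd_antisymm h1 h2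
  exact ⟨rfl, Nat.eq_of_mul_eq_mul_left (Nat.pos_of_ne_zero hs0) h⟩

theorem sum_Icc_inv_le {z : ℝ} (hz : 1 ≤ z) :
    ∑ n ∈ Finset.Icc 1 ⌊z⌋₊, (n : ℝ)⁻¹ ≤ 1 + Real.log z := by
  have h := harmonic_floor_le_one_add_log z hz
  rw [harmonic_eq_sum_Icc] at h
  push_cast at h
  exact h

theorem log_mul_sum_rough_inv_le {y z : ℝ} (hy : 1 ≤ y) (hyz : y ≤ z) :
    Real.log y * ∑ n ∈ (Finset.Icc 1 ⌊z⌋₊).filter (IsRough y), (n : ℝ)⁻¹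
      ≤ 1 + 2 * Real.log z := by
  have hz : 1 ≤ z := hy.trans hyz
  have hlog : Real.log y ≤ ∑ m ∈ Finset.Icc 1 (⌈y⌉₊ - 1), (m : ℝ)⁻¹ := by
    have h := log_add_one_le_harmonic (⌈y⌉₊ - 1)
    rw [Nat.sub_add_cancel (Nat.one_le_ceil_iff.2 (by linarith)), harmonic_eq_sum_Icc] at h
    push_cast at h
    exact (Real.log_le_log (by linarith) (Nat.le_ceil y)).trans h
  have hlt : ∀ m ∈ Finset.Icc 1 (⌈y⌉₊ - 1), 1 ≤ m ∧ (m : ℝ) < y := fun m hm => by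
    rw [Finset.mem_Icc] at hm
    exact ⟨hm.1, Nat.lt_ceil.1 (by omega)⟩
  have hsm : ∀ m ∈ Finset.Icc 1 (⌈y⌉₊ - 1), IsSmooth y m := fun m hm p _ hpm =>
    lt_of_le_of_lt (by exact_mod_cast Nat.le_of_dvd (hlt m hm).1 hpm) (hlt m hm).2
  calc Real.log y * ∑ n ∈ (Finset.Icc 1 ⌊z⌋₊).filter (IsRough y), (n : ℝ)⁻¹
      ≤ (∑ m ∈ Finset.Icc 1 (⌈y⌉₊ - 1), (m : ℝ)⁻¹) *
          ∑ n ∈ (Finset.Icc 1 ⌊z⌋₊).filter (IsRough y), (n : ℝ)⁻¹ := by gcongr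
    _ = ∑ q ∈ Finset.Icc 1 (⌈y⌉₊ - 1) ×ˢ (Finset.Icc 1 ⌊z⌋₊).filter (IsRough y),
          ((q.1 * q.2 : ℕ) : ℝ)⁻¹ := by
        rw [Finset.sum_mul_sum, Finset.sum_product]
        simp [mul_comm]
    _ = ∑ k ∈ (Finset.Icc 1 (⌈y⌉₊ - 1) ×ˢ (Finset.Icc 1 ⌊z⌋₊).filter (IsRough y)).image
          (fun q : ℕ × ℕ => (q.1 * q.2 : ℕ)), (k : ℝ)⁻¹ := by
        rw [Finset.sum_image (f := fun k : ℕ => (k : ℝ)⁻¹)]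
        rintro ⟨m, n⟩ h ⟨m', n'⟩ h' heq
        simp only [Finset.coe_product, Set.mem_prod, Finset.mem_coe, Finset.mem_filter] at h h'
        obtain ⟨h1, h2⟩ := eq_and_eq_of_isSmooth_mul_isRough (hsm m h.1) h.2.2 (hsm m' h'.1) h'.2.2
          (by have := (hlt m h.1).1; omega) heq
        rw [h1, h2]
    _ ≤ ∑ k ∈ Finset.Icc 1 ⌊z ^ 2⌋₊, (k : ℝ)⁻¹ := by
        refine Finset.sum_le_sum_of_subset_of_nonneg ?_ fun _ _ _ => by positivity
        intro k hk
        simp only [Finset.mem_image, Finset.mem_product, Finset.mem_filter, Prod.exists] at hk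
        obtain ⟨m, n, ⟨hm, hn, -⟩, rfl⟩ := hk
        rw [Finset.mem_Icc] at hn ⊢
        refine ⟨Nat.mul_pos (hlt m hm).1 hn.1, Nat.le_floor ?_⟩
        have h1 : (n : ℝ) ≤ z := (Nat.le_floor_iff (by linarith)).1 hn.2
        have h2 : (m : ℝ) ≤ z := (hlt m hm).2.le.trans hyz
        push_cast
        nlinarith [Nat.cast_nonneg (α := ℝ) m, Nat.cast_nonneg (α := ℝ) n]
    _ ≤ 1 + Real.log (z ^ 2) := sum_Icc_inv_le (by nlinarith)
    _ = 1 + 2 * Real.log z := by rw [Real.log_pow]; norm_num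

theorem sum_rough_log_le {y z : ℝ} (hz : 0 ≤ z) :
    ∑ n ∈ (Finset.Icc 1 ⌊z⌋₊).filter (IsRough y), Real.log n ≤
      (Real.log 4 + 4) * z * ∑ n ∈ (Finset.Icc 1 ⌊z⌋₊).filter (IsRough y), (n : ℝ)⁻¹ := by
  set S := (Finset.Icc 1 ⌊z⌋₊).filter (IsRough y) with hS
  calc ∑ n ∈ S, Real.log n
      = ∑ n ∈ S, ∑ m ∈ n.divisors, ArithmeticFunction.vonMangoldt (n / m) := by
        refine Finset.sum_congr rfl fun n _ => ?_
        rw [Nat.sum_div_divisors n fun d => ArithmeticFunction.vonMangoldt d,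
          ArithmeticFunction.vonMangoldt_sum]
    _ = ∑ q ∈ S.sigma fun n => n.divisors, ArithmeticFunction.vonMangoldt (q.1 / q.2) := by
        rw [Finset.sum_sigma]
    _ = ∑ q ∈ (S.sigma fun n => n.divisors).image
          (fun q => (⟨q.2, q.1 / q.2⟩ : (_ : ℕ) × ℕ)), ArithmeticFunction.vonMangoldt q.2 := by
        rw [Finset.sum_image]
        rintro ⟨n, m⟩ h ⟨n', m'⟩ h' heq
        simp only [Finset.coe_sigma, Set.mem_sigma_iff, Finset.mem_coe, Nat.mem_divisors] at h h'
        simp only [Sigma.mk.injEq, heq_eq_eq] at heq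
        obtain ⟨rfl, h2⟩ := heq
        have : n = n' := by
          rw [← Nat.div_mul_cancel h.2.1, ← Nat.div_mul_cancel h'.2.1, h2]
        rw [this]
    _ ≤ ∑ q ∈ S.sigma fun m => Finset.Ioc 0 ⌊z / m⌋₊, ArithmeticFunction.vonMangoldt q.2 := by
        refine Finset.sum_le_sum_of_subset_of_nonneg ?_
          fun _ _ _ => ArithmeticFunction.vonMangoldt_nonneg
        intro q hq
        simp only [Finset.mem_image, Finset.mem_sigma, Sigma.exists, Nat.mem_divisors] at hq
        obtain ⟨n, m, ⟨hn, hmn, hn0⟩, rfl⟩ := hq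
        obtain ⟨d, rfl⟩ := hmn
        have hm0 : 0 < m := Nat.pos_of_ne_zero (left_ne_zero_of_mul hn0)
        have hd0 : 0 < d := Nat.pos_of_ne_zero (right_ne_zero_of_mul hn0)
        rw [hS, Finset.mem_filter, Finset.mem_Icc] at hn
        simp only [hS, Finset.mem_sigma, Finset.mem_filter, Finset.mem_Icc, Finset.mem_Ioc,
          Nat.mul_div_cancel_left d hm0]
        refine ⟨⟨⟨hm0, (Nat.le_mul_of_pos_right m hd0).trans hn.1.2⟩,
          hn.2.of_dvd (dvd_mul_right m d)⟩, hd0, Nat.le_floor ?_⟩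
        rw [le_div_iff₀ (by exact_mod_cast hm0)]
        have := (Nat.le_floor_iff hz).1 hn.1.2
        push_cast at this
        linarith
    _ = ∑ m ∈ S, Chebyshev.psi (z / m) := by
        rw [Finset.sum_sigma]
        rfl
    _ ≤ ∑ m ∈ S, (Real.log 4 + 4) * (z / m) :=
        Finset.sum_le_sum fun m _ => Chebyshev.psi_le_const_mul_self (by positivity)
    _ = _ := by
        rw [Finset.mul_sum]
        exact Finset.sum_congr rfl fun m _ => by ring

theorem card_rough_le {y z : ℝ} (hy : 2 ≤ y) (hyz : y ≤ z) :
    (((Finset.Icc 1 ⌊z⌋₊).filter (IsRough y)).card : ℝ) ≤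
      4 * (Real.log 4 + 5) * (z / Real.log y) := by
  set S := (Finset.Icc 1 ⌊z⌋₊).filter (IsRough y) with hS
  have hz : 2 ≤ z := hy.trans hyz
  have hly : 0 < Real.log y := Real.log_pos (by linarith)
  have hlz : 1 ≤ 2 * Real.log z := by
    have := Real.log_le_log (by norm_num) hz
    linarith [Real.log_two_gt_d9]
  have h4 : 0 < Real.log 4 := Real.log_pos (by norm_num)
  have h1 : S.card * Real.log z ≤ (Real.log 4 + 5) * z * ∑ n ∈ S, (n : ℝ)⁻¹ := by
    have h : ∑ n ∈ S, Real.log z ≤ ∑ n ∈ S, (Real.log n + z * (n : ℝ)⁻¹) := by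
      refine Finset.sum_le_sum fun n hn => ?_
      rw [hS, Finset.mem_filter, Finset.mem_Icc] at hn
      have hn0 : (0 : ℝ) < n := by exact_mod_cast hn.1.1
      have := Real.log_le_self (show 0 ≤ z / n by positivity)
      rw [Real.log_div (by linarith) hn0.ne'] at this
      rw [← div_eq_mul_inv]
      linarith
    rw [Finset.sum_add_distrib, ← Finset.mul_sum, Finset.sum_const, nsmul_eq_mul] at h
    have := sum_rough_log_le (y := y) (z := z) (by linarith)
    rw [← hS] at this
    linarith
  have h2 := log_mul_sum_rough_inv_le (by linarith) hyz
  rw [← hS] at h2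
  have h3 : (S.card * Real.log y) * Real.log z ≤ (4 * (Real.log 4 + 5) * z) * Real.log z := by
    calc (S.card * Real.log y) * Real.log z = (S.card * Real.log z) * Real.log y := by ring
      _ ≤ ((Real.log 4 + 5) * z * ∑ n ∈ S, (n : ℝ)⁻¹) * Real.log y := by gcongr
      _ = (Real.log 4 + 5) * z * (Real.log y * ∑ n ∈ S, (n : ℝ)⁻¹) := by ring
      _ ≤ (Real.log 4 + 5) * z * (4 * Real.log z) :=
        mul_le_mul_of_nonneg_left (by linarith) (by positivity)
      _ = _ := by ring
  rw [← mul_div_assoc, le_div_iff₀ hly]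
  exact le_of_mul_le_mul_right h3 (by linarith)

theorem sum_inv_le_of_card_le {a C : ℝ} (ha0 : 0 < a) (ha1 : a < 1) (hC : 0 < C)
    {A : Set ℕ}
    (hA : ∀ x : ℝ, 2 ≤ x → (((Finset.Icc 1 ⌊x⌋₊).filter (fun n => n ∉ A)).card : ℝ)
        ≤ C * x * Real.log x ^ (-a)) {N : ℕ} (hN : 2 ≤ N) :
    ∑ n ∈ (Finset.Icc 1 N).filter (fun n => n ∉ A), (n : ℝ)⁻¹ ≤
      (((Finset.Icc 1 N).filter (fun n => n ∉ A)).card : ℝ) / N + 1 +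
        2 * C / (1 - a) * Real.log N ^ (1 - a) := by
  have ha : 0 < 1 - a := by linarith
  induction N, hN using Nat.le_induction with
  | base =>
    have h1 : (0 : ℝ) ≤ 2 * C / (1 - a) * Real.log (2 : ℕ) ^ (1 - a) := by positivity
    have hI : Finset.Icc 1 2 = ({1, 2} : Finset ℕ) := rfl
    rw [hI]
    by_cases h2 : 1 ∉ A <;> by_cases h3 : 2 ∉ A <;>
      simp [Finset.filter_insert, Finset.filter_singleton, h2, h3] at h1 ⊢ <;> linarith
  | succ N hN ih =>
    have hN2 : (2 : ℝ) ≤ N := by exact_mod_cast hN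
    have hcard := hA N hN2
    rw [Nat.floor_natCast] at hcard
    set S := (Finset.Icc 1 N).filter (fun n => n ∉ A) with hS
    have hu : 0 < Real.log ((N : ℝ) + 1) := Real.log_pos (by linarith)
    have hv : 0 < Real.log (N : ℝ) := Real.log_pos (by linarith)
    have huv : ((N : ℝ) + 1)⁻¹ ≤ Real.log ((N : ℝ) + 1) - Real.log N := by
      have h := Real.one_sub_inv_le_log_of_pos (show 0 < ((N : ℝ) + 1) / N by positivity)
      rw [Real.log_div (by positivity) (by positivity)] at h
      refine le_trans (le_of_eq ?_) h
      field_simp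
      ring
    have hu2 : Real.log ((N : ℝ) + 1) ≤ 2 * Real.log N := by
      have : Real.log ((N : ℝ) + 1) ≤ Real.log ((N : ℝ) ^ 2) :=
        Real.log_le_log (by positivity) (by nlinarith)
      rwa [Real.log_pow] at this
    have hpow : Real.log (N : ℝ) ^ (-a) ≤ 2 * Real.log ((N : ℝ) + 1) ^ (-a) := by
      have h : (2 * Real.log (N : ℝ)) ^ (-a) ≤ Real.log ((N : ℝ) + 1) ^ (-a) :=
        Real.rpow_le_rpow_of_nonpos hu hu2 (by linarith)
      rw [Real.mul_rpow (by norm_num) hv.le] at h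
      have h2 : (2 : ℝ)⁻¹ ≤ 2 ^ (-a) := by
        rw [← Real.rpow_neg_one]
        exact Real.rpow_le_rpow_of_exponent_le (by norm_num) (by linarith)
      have h3 : 0 < Real.log (N : ℝ) ^ (-a) := by positivity
      nlinarith
    have hconc : (1 - a) * Real.log ((N : ℝ) + 1) ^ (-a) * ((N : ℝ) + 1)⁻¹ ≤
        Real.log ((N : ℝ) + 1) ^ (1 - a) - Real.log N ^ (1 - a) := by
      set u := Real.log ((N : ℝ) + 1)
      set v := Real.log (N : ℝ)
      have hb := rpow_one_add_le_one_add_mul_self (s := v / u - 1)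
        (by have : 0 < v / u := by positivity
            linarith) ha.le (by linarith : 1 - a ≤ 1)
      rw [add_sub_cancel, Real.div_rpow hv.le hu.le, div_le_iff₀ (by positivity)] at hb
      have hsplit : u ^ (1 - a) = u * u ^ (-a) := by
        rw [sub_eq_add_neg, Real.rpow_add hu, Real.rpow_one]
      have hp : 0 < u ^ (-a) := by positivity
      calc (1 - a) * u ^ (-a) * ((N : ℝ) + 1)⁻¹ ≤ (1 - a) * u ^ (-a) * (u - v) := by gcongr
        _ = u ^ (1 - a) - (1 + (1 - a) * (v / u - 1)) * u ^ (1 - a) := by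
          rw [hsplit]
          field_simp
          ring
        _ ≤ _ := by linarith
    have hstep : (S.card : ℝ) / N - S.card / (N + 1) ≤
        2 * C / (1 - a) * (Real.log ((N : ℝ) + 1) ^ (1 - a) - Real.log N ^ (1 - a)) := by
      calc (S.card : ℝ) / N - S.card / (N + 1) = S.card / N * ((N : ℝ) + 1)⁻¹ := by
            field_simp
            ring
        _ ≤ (C * N * Real.log (N : ℝ) ^ (-a)) / N * ((N : ℝ) + 1)⁻¹ := by gcongr
        _ = C * Real.log (N : ℝ) ^ (-a) * ((N : ℝ) + 1)⁻¹ := by field_simp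
        _ ≤ C * (2 * Real.log ((N : ℝ) + 1) ^ (-a)) * ((N : ℝ) + 1)⁻¹ := by gcongr
        _ = 2 * C / (1 - a) * ((1 - a) * Real.log ((N : ℝ) + 1) ^ (-a) * ((N : ℝ) + 1)⁻¹) := by
            field_simp
        _ ≤ _ := by gcongr
    rw [← Finset.insert_Icc_right_eq_Icc_add_one (by omega : 1 ≤ N + 1), Finset.filter_insert]
    push_cast
    split_ifs with h
    · linarith
    · rw [Finset.sum_insert (by simp), Finset.card_insert_of_notMem (by simp)]
      push_cast
      rw [add_div, ← one_div]
      linarith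

theorem sum_inv_le_log_rpow {a : ℝ} (ha0 : 0 < a) (ha1 : a < 1) {A : Set ℕ}
    (hA : ∃ C : ℝ, 0 < C ∧ ∀ x : ℝ, 2 ≤ x →
      (((Finset.Icc 1 ⌊x⌋₊).filter (fun n => n ∉ A)).card : ℝ) ≤ C * x * Real.log x ^ (-a)) :
    ∃ C : ℝ, 0 < C ∧ ∀ w : ℝ, Real.exp 1 ≤ w →
      ∑ n ∈ (Finset.Icc 1 ⌊w⌋₊).filter (fun n => n ∉ A), (n : ℝ)⁻¹ ≤
        C * Real.log w ^ (1 - a) := by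
  obtain ⟨C, hC, hA⟩ := hA
  have ha : 0 < 1 - a := by linarith
  refine ⟨2 + 2 * C / (1 - a), by positivity, fun w hw => ?_⟩
  have hw2 : 2 ≤ w := by linarith [Real.exp_one_gt_d9]
  have hN : 2 ≤ ⌊w⌋₊ := Nat.le_floor (by exact_mod_cast hw2)
  have hN0 : (0 : ℝ) < ⌊w⌋₊ := by exact_mod_cast (by omega : 0 < ⌊w⌋₊)
  have h1 := sum_inv_le_of_card_le ha0 ha1 hC hA hN
  have h2 : (((Finset.Icc 1 ⌊w⌋₊).filter (fun n => n ∉ A)).card : ℝ) / ⌊w⌋₊ ≤ 1 := by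
    rw [div_le_one hN0]
    exact_mod_cast (Finset.card_filter_le _ _).trans (by simp)
  have h3 : Real.log ⌊w⌋₊ ≤ Real.log w := Real.log_le_log hN0 (Nat.floor_le (by linarith))
  have h4 : 1 ≤ Real.log w := by
    rwa [Real.le_log_iff_exp_le (by linarith)]
  have h5 : 1 ≤ Real.log w ^ (1 - a) := Real.one_le_rpow h4 ha.le
  have h6 : 2 * C / (1 - a) * Real.log ⌊w⌋₊ ^ (1 - a) ≤
      2 * C / (1 - a) * Real.log w ^ (1 - a) := by
    have : 0 ≤ Real.log (⌊w⌋₊ : ℝ) := Real.log_natCast_nonneg _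
    gcongr
  linarith

theorem two_pow_card_primeFactors_le_card_divisors {n : ℕ} (hn : n ≠ 0) :
    2 ^ n.primeFactors.card ≤ n.divisors.card := by
  rw [Nat.card_divisors hn]
  refine Finset.pow_card_le_prod _ _ _ fun p hp => ?_
  have := (Nat.prime_of_mem_primeFactors hp).factorization_pos_of_dvd hn
    (Nat.dvd_of_mem_primeFactors hp)
  omega

theorem card_filter_dvd_le {x : ℝ} (hx : 0 ≤ x) (d : ℕ) :
    (((Finset.Icc 1 ⌊x⌋₊).filter (fun n => d ∣ n)).card : ℝ) ≤ x / d := by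
  have h : (Finset.Icc 1 ⌊x⌋₊).filter (fun n => d ∣ n) =
      {n ∈ Finset.Ioc 0 ⌊x⌋₊ | d ∣ n} := by
    ext n
    simp [Nat.succ_le_iff]
  rw [h, Nat.Ioc_filter_dvd_card_eq_div]
  exact Nat.cast_div_le.trans (by gcongr; exact Nat.floor_le hx)

theorem sum_card_divisors_le {x : ℝ} (hx : 1 ≤ x) :
    ∑ n ∈ Finset.Icc 1 ⌊x⌋₊, (n.divisors.card : ℝ) ≤ x * (1 + Real.log x) := by
  have h := ArithmeticFunction.sum_Ioc_sigma0_eq_sum_div ⌊x⌋₊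
  simp only [ArithmeticFunction.sigma_zero_apply] at h
  calc ∑ n ∈ Finset.Icc 1 ⌊x⌋₊, (n.divisors.card : ℝ)
      = ((∑ n ∈ Finset.Ioc 0 ⌊x⌋₊, n.divisors.card : ℕ) : ℝ) := by push_cast; rfl
    _ = ∑ n ∈ Finset.Icc 1 ⌊x⌋₊, ((⌊x⌋₊ / n : ℕ) : ℝ) := by rw [h]; push_cast; rfl
    _ ≤ ∑ n ∈ Finset.Icc 1 ⌊x⌋₊, x * (n : ℝ)⁻¹ := by
        refine Finset.sum_le_sum fun n _ => ?_
        rw [← div_eq_mul_inv]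
        exact Nat.cast_div_le.trans (by gcongr; exact Nat.floor_le (by linarith))
    _ ≤ x * (1 + Real.log x) := by
        rw [← Finset.mul_sum]
        exact mul_le_mul_of_nonneg_left (sum_Icc_inv_le hx) (by linarith)

theorem card_le_of_two_rpow_le_card_divisors {x k : ℝ} (hx : 1 ≤ x) :
    (((Finset.Icc 1 ⌊x⌋₊).filter (fun n => (2 : ℝ) ^ k ≤ n.divisors.card)).card : ℝ) ≤
      x * (1 + Real.log x) * 2 ^ (-k) := by
  have h2 : (0 : ℝ) < 2 ^ k := by positivity
  rw [Real.rpow_neg (by norm_num), ← div_eq_mul_inv, le_div_iff₀ h2, ← nsmul_eq_mul]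
  refine (Finset.card_nsmul_le_sum _ (fun n : ℕ => (n.divisors.card : ℝ)) _
    fun n hn => (Finset.mem_filter.1 hn).2).trans ?_
  exact (Finset.sum_le_sum_of_subset_of_nonneg (Finset.filter_subset _ _)
    fun _ _ _ => Nat.cast_nonneg _).trans (sum_card_divisors_le hx)

theorem card_exists_sq_dvd_le {x V : ℝ} (hx : 0 ≤ x) (hV : 0 < V) :
    (((Finset.Icc 1 ⌊x⌋₊).filter (fun n => ∃ v : ℕ, V < v ∧ v ^ 2 ∣ n)).card : ℝ) ≤
      2 * x / V := by
  have hsub : (Finset.Icc 1 ⌊x⌋₊).filter (fun n => ∃ v : ℕ, V < v ∧ v ^ 2 ∣ n) ⊆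
      (Finset.Ioo ⌊V⌋₊ (⌊x⌋₊ + 1)).biUnion
        fun v => (Finset.Icc 1 ⌊x⌋₊).filter (fun n => v ^ 2 ∣ n) := by
    intro n hn
    simp only [Finset.mem_filter, Finset.mem_Icc, Finset.mem_biUnion, Finset.mem_Ioo] at hn ⊢
    obtain ⟨hn, v, hv, hvn⟩ := hn
    refine ⟨v, ⟨(Nat.floor_lt hV.le).2 hv, ?_⟩, hn, hvn⟩
    have := Nat.le_of_dvd hn.1 hvn
    nlinarith [Nat.le_self_pow two_ne_zero v]
  calc (((Finset.Icc 1 ⌊x⌋₊).filter (fun n => ∃ v : ℕ, V < v ∧ v ^ 2 ∣ n)).card : ℝ)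
      ≤ ∑ v ∈ Finset.Ioo ⌊V⌋₊ (⌊x⌋₊ + 1),
          (((Finset.Icc 1 ⌊x⌋₊).filter (fun n => v ^ 2 ∣ n)).card : ℝ) := by
        exact_mod_cast (Finset.card_le_card hsub).trans Finset.card_biUnion_le
    _ ≤ ∑ v ∈ Finset.Ioo ⌊V⌋₊ (⌊x⌋₊ + 1), x * ((v : ℝ) ^ 2)⁻¹ := by
        refine Finset.sum_le_sum fun v _ => ?_
        have := card_filter_dvd_le hx (v ^ 2)
        rwa [Nat.cast_pow, div_eq_mul_inv] at this
    _ ≤ x * (2 / (⌊V⌋₊ + 1)) := by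
        rw [← Finset.mul_sum]
        exact mul_le_mul_of_nonneg_left (sum_Ioo_inv_sq_le _ _) hx
    _ ≤ x * (2 / V) := by
        gcongr
        exact (Nat.lt_floor_add_one V).le
    _ = 2 * x / V := by ring

theorem IsSmooth.log_le {y : ℝ} {u : ℕ} (hu : Squarefree u) (hs : IsSmooth y u) :
    Real.log u ≤ u.primeFactors.card * Real.log y := by
  have h : (u : ℝ) ≤ y ^ u.primeFactors.card := by
    calc (u : ℝ) = ∏ p ∈ u.primeFactors, (p : ℝ) := by
          rw [← Nat.cast_prod, Nat.prod_primeFactors_of_squarefree hu]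
      _ ≤ ∏ _p ∈ u.primeFactors, y := Finset.prod_le_prod (fun _ _ => Nat.cast_nonneg _)
          fun p hp => (hs p (Nat.prime_of_mem_primeFactors hp) (Nat.dvd_of_mem_primeFactors hp)).le
      _ = _ := Finset.prod_const _
  rw [← Real.log_pow]
  exact Real.log_le_log (by exact_mod_cast Nat.pos_of_ne_zero hu.ne_zero) h

theorem card_exists_large_smooth_dvd_le {x y w : ℝ} (hx : 1 ≤ x) (hy : 1 < y) (hw : 0 < w) :
    (((Finset.Icc 1 ⌊x⌋₊).filter (fun n => ∃ s : ℕ, w < s ∧ IsSmooth y s ∧ s ∣ n)).card : ℝ) ≤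
      x * (1 + Real.log x) * 2 ^ (-(Real.log w / (2 * Real.log y))) + 2 * x / w ^ (1 / 4 : ℝ) := by
  have hly : 0 < Real.log y := Real.log_pos hy
  have hsub : (Finset.Icc 1 ⌊x⌋₊).filter (fun n => ∃ s : ℕ, w < s ∧ IsSmooth y s ∧ s ∣ n) ⊆
      (Finset.Icc 1 ⌊x⌋₊).filter
        (fun n => (2 : ℝ) ^ (Real.log w / (2 * Real.log y)) ≤ n.divisors.card) ∪
      (Finset.Icc 1 ⌊x⌋₊).filter (fun n => ∃ v : ℕ, w ^ (1 / 4 : ℝ) < v ∧ v ^ 2 ∣ n) := by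
    intro n hn
    rw [Finset.mem_filter] at hn
    obtain ⟨hn, s, hws, hs, hsn⟩ := hn
    rw [Finset.mem_union, Finset.mem_filter, Finset.mem_filter]
    have hn0 : n ≠ 0 := by
      rw [Finset.mem_Icc] at hn
      omega
    obtain ⟨u, v, rfl, hu⟩ := Nat.sq_mul_squarefree s
    have hun : u ∣ n := (dvd_mul_left u _).trans hsn
    rcases le_or_gt (w ^ (1 / 2 : ℝ)) u with h | h
    · refine Or.inl ⟨hn, ?_⟩
      have h1 := (hs.of_dvd (dvd_mul_left u _)).log_le hu
      have h2 := Real.log_le_log (by positivity) h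
      rw [Real.log_rpow hw] at h2
      have h3 : Real.log w / (2 * Real.log y) ≤ u.primeFactors.card := by
        rw [div_le_iff₀ (by positivity)]
        linarith
      calc (2 : ℝ) ^ (Real.log w / (2 * Real.log y)) ≤ 2 ^ (u.primeFactors.card : ℝ) :=
            Real.rpow_le_rpow_of_exponent_le (by norm_num) h3
        _ = ((2 ^ u.primeFactors.card : ℕ) : ℝ) := by rw [Real.rpow_natCast]; norm_cast
        _ ≤ u.divisors.card := by
            exact_mod_cast two_pow_card_primeFactors_le_card_divisors hu.ne_zero
        _ ≤ n.divisors.card := by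
            exact_mod_cast Finset.card_le_card (Nat.divisors_subset_of_dvd hn0 hun)
    · refine Or.inr ⟨hn, v, ?_, (dvd_mul_right _ u).trans hsn⟩
      have hw2 : w = w ^ (1 / 2 : ℝ) * w ^ (1 / 2 : ℝ) := by
        rw [← Real.rpow_add hw]
        norm_num
      have hw4 : w ^ (1 / 2 : ℝ) = (w ^ (1 / 4 : ℝ)) ^ 2 := by
        rw [← Real.rpow_natCast, ← Real.rpow_mul hw.le]
        norm_num
      have hp : 0 < w ^ (1 / 2 : ℝ) := by positivity
      push_cast at hws
      have h5 : w ^ (1 / 2 : ℝ) < (v : ℝ) ^ 2 := by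
        by_contra! hle
        have : (v : ℝ) ^ 2 * u ≤ w ^ (1 / 2 : ℝ) * w ^ (1 / 2 : ℝ) := by gcongr
        linarith
      rw [hw4] at h5
      exact lt_of_pow_lt_pow_left₀ 2 (Nat.cast_nonneg v) h5
  refine (Nat.cast_le.2 ((Finset.card_le_card hsub).trans (Finset.card_union_le _ _))).trans ?_
  push_cast
  exact add_le_add (card_le_of_two_rpow_le_card_divisors hx)
    (card_exists_sq_dvd_le (by linarith) (by positivity))

theorem filter_notMem_mul_subset (A B : Set ℕ) (x y w : ℝ) :
    (Finset.Icc 1 ⌊x⌋₊).filter (fun n => n ∉ A * B) ⊆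
      ((Finset.Icc 1 ⌊x⌋₊).filter (fun n => ∃ s : ℕ, w < s ∧ IsSmooth y s ∧ s ∣ n) ∪
      ((Finset.Icc 1 ⌊w⌋₊).filter (fun s => s ∉ A)).biUnion fun s =>
        ((Finset.Icc 1 ⌊x / s⌋₊).filter (IsRough y)).image (s * ·)) ∪
      (Finset.Icc 1 ⌊w⌋₊).biUnion fun s =>
        ((Finset.Icc 1 ⌊x / s⌋₊).filter (fun r => r ∉ B)).image (s * ·) := by
  intro n hn
  simp only [Finset.mem_filter, Finset.mem_Icc] at hn
  obtain ⟨⟨hn1, hnx⟩, hnAB⟩ := hn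
  obtain ⟨s, r, hs, hr, rfl⟩ := exists_isSmooth_mul_isRough y (by omega : n ≠ 0)
  have hs0 : 0 < s := Nat.pos_of_mul_pos_right hn1
  have hr0 : 0 < r := Nat.pos_of_mul_pos_left hn1
  have hrx : r ≤ ⌊x / s⌋₊ := by
    rw [Nat.floor_div_natCast, Nat.le_div_iff_mul_le hs0, mul_comm]
    exact hnx
  simp only [Finset.mem_union, Finset.mem_filter, Finset.mem_Icc, Finset.mem_biUnion,
    Finset.mem_image]
  rcases lt_or_ge w s with h | h
  · exact Or.inl (Or.inl ⟨⟨hn1, hnx⟩, s, h, hs, dvd_mul_right s r⟩)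
  · have hsw : s ≤ ⌊w⌋₊ := Nat.le_floor h
    by_cases hA : s ∈ A
    · exact Or.inr ⟨s, ⟨hs0, hsw⟩, r, ⟨⟨hr0, hrx⟩, fun hB => hnAB (Set.mul_mem_mul hA hB)⟩, rfl⟩
    · exact Or.inl (Or.inr ⟨s, ⟨⟨hs0, hsw⟩, hA⟩, r, ⟨⟨hr0, hrx⟩, hr⟩, rfl⟩)

theorem card_notMem_mul_le {a : ℝ} (ha0 : 0 < a) (ha1 : a < 1) {A B : Set ℕ}
    (hA : ∃ C : ℝ, 0 < C ∧ ∀ x : ℝ, 2 ≤ x →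
      (((Finset.Icc 1 ⌊x⌋₊).filter (fun n => n ∉ A)).card : ℝ) ≤ C * x * Real.log x ^ (-a))
    (hB : ∃ C : ℝ, 0 < C ∧ ∀ x : ℝ, 2 ≤ x →
      (((Finset.Icc 1 ⌊x⌋₊).filter (fun n => n ∉ B)).card : ℝ) ≤ C * x * Real.log x ^ (-a)) :
    ∃ C : ℝ, 0 < C ∧ ∀ x y w : ℝ, 2 ≤ y → Real.exp 1 ≤ w → y * w ≤ x → w ^ 2 ≤ x →
      (((Finset.Icc 1 ⌊x⌋₊).filter (fun n => n ∉ A * B)).card : ℝ) ≤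
        x * (1 + Real.log x) * 2 ^ (-(Real.log w / (2 * Real.log y))) +
          2 * x / w ^ (1 / 4 : ℝ) +
        C * x * (Real.log w ^ (1 - a) / Real.log y) +
        C * x * (Real.log w * Real.log x ^ (-a)) := by
  obtain ⟨CA, hCA, hA⟩ := sum_inv_le_log_rpow ha0 ha1 hA
  obtain ⟨CB, hCB, hB⟩ := hB
  have hl4 : 0 < Real.log 4 := Real.log_pos (by norm_num)
  refine ⟨4 * (Real.log 4 + 5) * CA + 4 * CB, by positivity, fun x y w hy hw hyw hwx => ?_⟩
  have hw2 : 2 ≤ w := by linarith [Real.exp_one_gt_d9]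
  have hx : 4 ≤ x := by nlinarith
  have hly : 0 < Real.log y := Real.log_pos (by linarith)
  have hlx : 0 < Real.log x := Real.log_pos (by linarith)
  have hlw : 1 ≤ Real.log w := by
    rwa [Real.le_log_iff_exp_le (by linarith)]
  have hs : ∀ s ∈ Finset.Icc 1 ⌊w⌋₊, (0 : ℝ) < s ∧ (s : ℝ) ≤ w := fun s hs => by
    rw [Finset.mem_Icc] at hs
    exact ⟨by exact_mod_cast hs.1, (Nat.le_floor_iff (by linarith)).1 hs.2⟩
  have hxs : ∀ s ∈ Finset.Icc 1 ⌊w⌋₊, y ≤ x / s := fun s h => by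
    rw [le_div_iff₀ (hs s h).1]
    nlinarith [(hs s h).2]
  have hrough : ∑ s ∈ (Finset.Icc 1 ⌊w⌋₊).filter (fun s => s ∉ A),
      (((Finset.Icc 1 ⌊x / s⌋₊).filter (IsRough y)).card : ℝ) ≤
      4 * (Real.log 4 + 5) * CA * x * (Real.log w ^ (1 - a) / Real.log y) := by
    calc _ ≤ ∑ s ∈ (Finset.Icc 1 ⌊w⌋₊).filter (fun s => s ∉ A),
          4 * (Real.log 4 + 5) * (x / Real.log y) * (s : ℝ)⁻¹ := by
          refine Finset.sum_le_sum fun s h => ?_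
          refine (card_rough_le hy (hxs s (Finset.mem_filter.1 h).1)).trans_eq ?_
          have := (hs s (Finset.mem_filter.1 h).1).1
          field_simp
      _ ≤ 4 * (Real.log 4 + 5) * (x / Real.log y) * (CA * Real.log w ^ (1 - a)) := by
          rw [← Finset.mul_sum]
          exact mul_le_mul_of_nonneg_left (hA w hw) (by positivity)
      _ = _ := by ring
  have hBsum : ∑ s ∈ Finset.Icc 1 ⌊w⌋₊,
      (((Finset.Icc 1 ⌊x / s⌋₊).filter (fun r => r ∉ B)).card : ℝ) ≤
      4 * CB * x * (Real.log w * Real.log x ^ (-a)) := by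
    calc _ ≤ ∑ s ∈ Finset.Icc 1 ⌊w⌋₊, 2 * CB * x * Real.log x ^ (-a) * (s : ℝ)⁻¹ := by
          refine Finset.sum_le_sum fun s h => ?_
          have hs0 := (hs s h).1
          refine (hB _ (hy.trans (hxs s h))).trans ?_
          have h1 : Real.log x / 2 ≤ Real.log (x / s) := by
            rw [Real.log_div (by linarith) hs0.ne']
            have h2 := Real.log_le_log hs0 (hs s h).2
            have h3 := Real.log_le_log (by positivity) hwx
            rw [Real.log_pow] at h3
            push_cast at h3
            linarith
          have h2 : Real.log (x / s) ^ (-a) ≤ 2 * Real.log x ^ (-a) := by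
            refine (Real.rpow_le_rpow_of_nonpos (by positivity) h1 (by linarith)).trans ?_
            rw [Real.div_rpow hlx.le (by norm_num), Real.rpow_neg (by norm_num : (0 : ℝ) ≤ 2),
              div_inv_eq_mul, mul_comm]
            gcongr
            calc (2 : ℝ) ^ a ≤ 2 ^ (1 : ℝ) :=
                  Real.rpow_le_rpow_of_exponent_le (by norm_num) ha1.le
              _ = 2 := Real.rpow_one 2
          calc CB * (x / s) * Real.log (x / s) ^ (-a)
              ≤ CB * (x / s) * (2 * Real.log x ^ (-a)) := by gcongr
            _ = _ := by ring
      _ ≤ 2 * CB * x * Real.log x ^ (-a) * (2 * Real.log w) := by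
          rw [← Finset.mul_sum]
          refine mul_le_mul_of_nonneg_left ?_ (by positivity)
          linarith [sum_Icc_inv_le (by linarith : 1 ≤ w)]
      _ = _ := by ring
  have hcard := (Finset.card_le_card (filter_notMem_mul_subset A B x y w)).trans
    ((Finset.card_union_le _ _).trans (add_le_add ((Finset.card_union_le _ _).trans
      (add_le_add le_rfl (Finset.card_biUnion_le.trans
        (Finset.sum_le_sum fun _ _ => Finset.card_image_le))))
      (Finset.card_biUnion_le.trans (Finset.sum_le_sum fun _ _ => Finset.card_image_le))))
  have hcard' := Nat.cast_le (α := ℝ).2 hcard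
  push_cast at hcard'
  have hlarge := card_exists_large_smooth_dvd_le (x := x) (y := y) (w := w) (by linarith)
    (by linarith) (by linarith)
  have e1 : 0 ≤ 4 * CB * x * (Real.log w ^ (1 - a) / Real.log y) := by positivity
  have e2 : 0 ≤ 4 * (Real.log 4 + 5) * CA * x * (Real.log w * Real.log x ^ (-a)) := by positivity
  linarith

theorem exists_mul_exp_neg_rpow_le {c η : ℝ} (hc : 0 < c) (hη : 0 < η) :
    ∃ C : ℝ, 0 < C ∧ ∀ L : ℝ, 1 ≤ L → L * Real.exp (-(c * L ^ η)) ≤ C * L⁻¹ := by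
  obtain ⟨k, hk⟩ := exists_nat_ge (2 / η)
  rw [div_le_iff₀ hη] at hk
  refine ⟨k.factorial / c ^ k, by positivity, fun L hL => ?_⟩
  have hL0 : 0 < L := by linarith
  have h1 : (c * L ^ η) ^ k / k.factorial ≤ Real.exp (c * L ^ η) :=
    Real.pow_div_factorial_le_exp _ (by positivity) k
  have h2 : L ^ 2 ≤ (L ^ η) ^ k := by
    rw [← Real.rpow_natCast, ← Real.rpow_natCast, ← Real.rpow_mul hL0.le]
    exact Real.rpow_le_rpow_of_exponent_le hL (by push_cast; linarith)
  have h3 : c ^ k * L ^ 2 / k.factorial ≤ Real.exp (c * L ^ η) := by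
    refine le_trans ?_ h1
    rw [mul_pow]
    gcongr
  rw [Real.exp_neg, ← div_eq_mul_inv, div_le_iff₀ (Real.exp_pos _)]
  calc L = k.factorial / c ^ k * L⁻¹ * (c ^ k * L ^ 2 / k.factorial) := by
        have : (k.factorial : ℝ) ≠ 0 := by positivity
        field_simp
    _ ≤ _ := by gcongr

theorem exists_one_le_mul_rpow {l M : ℝ} (hl : 0 < l) (hM : 0 < M) (e : ℝ) :
    ∃ C : ℝ, 0 < C ∧ ∀ L : ℝ, l ≤ L → L ≤ M → 1 ≤ C * L ^ e := by
  refine ⟨l ^ (-e) + M ^ (-e), by positivity, fun L h1 h2 => ?_⟩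
  have hL : 0 < L := hl.trans_le h1
  have h : L ^ (-e) ≤ l ^ (-e) + M ^ (-e) := by
    have p1 : 0 < l ^ (-e) := by positivity
    have p2 : 0 < M ^ (-e) := by positivity
    rcases le_total 0 e with he | he
    · linarith [Real.rpow_le_rpow_of_nonpos hl h1 (by linarith : -e ≤ 0)]
    · linarith [Real.rpow_le_rpow hL.le h2 (by linarith : 0 ≤ -e)]
  calc (1 : ℝ) = L ^ (-e) * L ^ e := by rw [← Real.rpow_add hL]; simp
    _ ≤ _ := by gcongr

theorem quantitative_product_set_bound
    (a : ℝ) (ha0 : 0 < a) (ha1 : a < 1) (A B : Set ℕ)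
    (hA : ∃ C : ℝ, 0 < C ∧ ∀ x : ℝ, 2 ≤ x →
      (((Finset.Icc 1 ⌊x⌋₊).filter (fun n => n ∉ A)).card : ℝ)
        ≤ C * x * Real.log x ^ (-a))
    (hB : ∃ C : ℝ, 0 < C ∧ ∀ x : ℝ, 2 ≤ x →
      (((Finset.Icc 1 ⌊x⌋₊).filter (fun n => n ∉ B)).card : ℝ)
        ≤ C * x * Real.log x ^ (-a)) :
    ∀ ε : ℝ, 0 < ε →
      ∃ C : ℝ, 0 < C ∧ ∀ x : ℝ, 2 ≤ x →
        (((Finset.Icc 1 ⌊x⌋₊).filter (fun n => n ∉ A * B)).card : ℝ)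
          ≤ C * x * Real.log x ^ (-(a ^ 2 / (1 + a)) + ε) := by
  intro ε hε
  set e : ℝ := -(a ^ 2 / (1 + a)) + ε with he
  set θ : ℝ := a / (1 + a) with hθ
  set η : ℝ := min ε (1 / 4) with hη
  have hη0 : 0 < η := lt_min hε (by norm_num)
  have hηε : η ≤ ε := min_le_left _ _
  have hη4 : η ≤ 1 / 4 := min_le_right _ _
  have hθ0 : 0 < θ := by positivity
  have hθ2 : θ ≤ 1 / 2 := by
    rw [hθ, div_le_div_iff₀ (by linarith) (by norm_num)]
    linarith
  have hθa : θ * a = a ^ 2 / (1 + a) := by rw [hθ]; ring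
  have hθa' : a - θ = a ^ 2 / (1 + a) := by
    rw [hθ]
    field_simp
    ring
  have he1 : -1 ≤ e := by
    have : θ * a ≤ 1 := by nlinarith
    linarith
  have hl2 : 0 < Real.log 2 := Real.log_pos (by norm_num)
  obtain ⟨C₁, hC₁, hmain⟩ := card_notMem_mul_le ha0 ha1 hA hB
  obtain ⟨C₂, hC₂, hexp⟩ := exists_mul_exp_neg_rpow_le (c := 1 / 4) (by norm_num) hη0
  obtain ⟨C₃, hC₃, hsmall⟩ := exists_one_le_mul_rpow hl2 (by norm_num : (0 : ℝ) < 16) e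
  refine ⟨C₃ + (4 * C₂ + 2 * C₁), by positivity, fun x hx => ?_⟩
  have hL0 : 0 < Real.log x := Real.log_pos (by linarith)
  set L := Real.log x with hL
  have hLe : 0 < L ^ e := by positivity
  rcases le_total L 16 with hL16 | hL16
  · have h1 : (((Finset.Icc 1 ⌊x⌋₊).filter (fun n => n ∉ A * B)).card : ℝ) ≤ x := by
      refine le_trans ?_ (Nat.floor_le (by linarith : 0 ≤ x))
      exact_mod_cast (Finset.card_filter_le _ _).trans (by simp)
    have h2 := hsmall L (Real.log_le_log (by norm_num) hx) hL16
    have h3 : 0 ≤ (4 * C₂ + 2 * C₁) * x * L ^ e := by positivity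
    nlinarith
  · have hL1 : 1 ≤ L := by linarith
    have hLθ : 1 ≤ L ^ θ := Real.one_le_rpow hL1 hθ0.le
    have hLη : 1 ≤ L ^ η := Real.one_le_rpow hL1 hη0.le
    have hle : L ^ θ ≤ L ^ (θ + η) := Real.rpow_le_rpow_of_exponent_le hL1 (by linarith)
    have hle' : L ^ η ≤ L ^ (θ + η) := Real.rpow_le_rpow_of_exponent_le hL1 (by linarith)
    have hhalf : 2 * L ^ (θ + η) ≤ L := by
      have h1 : L ^ (θ + η) ≤ L ^ (3 / 4 : ℝ) :=
        Real.rpow_le_rpow_of_exponent_le hL1 (by linarith)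
      have h2 : (2 : ℝ) ≤ L ^ (1 / 4 : ℝ) := by
        have : (16 : ℝ) ^ (1 / 4 : ℝ) ≤ L ^ (1 / 4 : ℝ) :=
          Real.rpow_le_rpow (by norm_num) hL16 (by norm_num)
        rwa [show (16 : ℝ) = 2 ^ (4 : ℝ) by norm_num, ← Real.rpow_mul (by norm_num),
          show (4 : ℝ) * (1 / 4) = 1 by norm_num, Real.rpow_one] at this
      calc 2 * L ^ (θ + η) ≤ L ^ (1 / 4 : ℝ) * L ^ (3 / 4 : ℝ) := by gcongr
        _ = L := by
          rw [← Real.rpow_add hL0]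
          norm_num
    have hxexp : x = Real.exp L := (Real.exp_log (by linarith)).symm
    have hexp1 := Real.exp_one_gt_d9
    have hb := hmain x (Real.exp (L ^ θ)) (Real.exp (L ^ (θ + η)))
      (by linarith [Real.exp_le_exp.2 hLθ])
      (Real.exp_le_exp.2 (hLθ.trans hle))
      (by rw [← Real.exp_add, hxexp]; exact Real.exp_le_exp.2 (by linarith))
      (by rw [← Real.exp_nat_mul, hxexp]; exact Real.exp_le_exp.2 (by push_cast; linarith))
    rw [Real.log_exp, Real.log_exp, ← hL] at hb
    have hinv : L⁻¹ ≤ L ^ e := by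
      rw [← Real.rpow_neg_one]
      exact Real.rpow_le_rpow_of_exponent_le hL1 he1
    have hE : L * Real.exp (-(1 / 4 * L ^ η)) ≤ C₂ * L ^ e := (hexp L hL1).trans (by gcongr)
    have t1 : (2 : ℝ) ^ (-(L ^ (θ + η) / (2 * L ^ θ))) ≤ Real.exp (-(1 / 4 * L ^ η)) := by
      rw [Real.rpow_add hL0, Real.rpow_def_of_pos (by norm_num)]
      refine Real.exp_le_exp.2 ?_
      have : L ^ θ * L ^ η / (2 * L ^ θ) = L ^ η / 2 := by field_simp
      rw [this]
      nlinarith [Real.log_two_gt_d9]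
    have t2 : (Real.exp (L ^ (θ + η)) ^ (1 / 4 : ℝ))⁻¹ ≤ Real.exp (-(1 / 4 * L ^ η)) := by
      rw [← Real.exp_mul, ← Real.exp_neg]
      exact Real.exp_le_exp.2 (by linarith)
    have t3 : (L ^ (θ + η)) ^ (1 - a) / L ^ θ ≤ L ^ e := by
      rw [← Real.rpow_mul hL0.le, ← Real.rpow_sub hL0]
      exact Real.rpow_le_rpow_of_exponent_le hL1 (by nlinarith)
    have t4 : L ^ (θ + η) * L ^ (-a) ≤ L ^ e := by
      rw [← Real.rpow_add hL0]
      exact Real.rpow_le_rpow_of_exponent_le hL1 (by linarith)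
    have hx0 : 0 < x := by linarith
    have s1 : x * (1 + L) * 2 ^ (-(L ^ (θ + η) / (2 * L ^ θ))) ≤ 2 * C₂ * x * L ^ e := by
      calc x * (1 + L) * 2 ^ (-(L ^ (θ + η) / (2 * L ^ θ)))
          ≤ x * (2 * L) * Real.exp (-(1 / 4 * L ^ η)) := by
            gcongr
            linarith
        _ = 2 * x * (L * Real.exp (-(1 / 4 * L ^ η))) := by ring
        _ ≤ 2 * x * (C₂ * L ^ e) := mul_le_mul_of_nonneg_left hE (by positivity)
        _ = _ := by ring
    have s2 : 2 * x / Real.exp (L ^ (θ + η)) ^ (1 / 4 : ℝ) ≤ 2 * C₂ * x * L ^ e := by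
      calc 2 * x / Real.exp (L ^ (θ + η)) ^ (1 / 4 : ℝ)
          ≤ 2 * x * (1 * Real.exp (-(1 / 4 * L ^ η))) := by
            rw [div_eq_mul_inv, one_mul]
            gcongr
        _ ≤ 2 * x * (L * Real.exp (-(1 / 4 * L ^ η))) := by gcongr
        _ ≤ 2 * x * (C₂ * L ^ e) := mul_le_mul_of_nonneg_left hE (by positivity)
        _ = _ := by ring
    have s3 : C₁ * x * ((L ^ (θ + η)) ^ (1 - a) / L ^ θ) ≤ C₁ * x * L ^ e := by gcongr
    have s4 : C₁ * x * (L ^ (θ + η) * L ^ (-a)) ≤ C₁ * x * L ^ e := by gcongr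
    have s5 : 0 ≤ C₃ * x * L ^ e := by positivity
    linarith
end
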